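/- arXiv:2504.09400 — 5 statements merged into one kernel-verified Lean document; each statement's English description precedes it below -/
import Mathlib

section
/- Let X and Y be sets equipped with functions Ht_X : X → ℝ_{>0} and Ht_Y : Y → ℝ_{>0} such that for every real B the sets {x ∈ X : Ht_X(x) ≤ B} and {y ∈ Y : Ht_Y(y) ≤ B} are finite. Let c_X, c_Y > 0 and α > 0 be real numbers, and let β_X, β_Y be real numbers with β_Y ≥ 0 and β_X > −1. Assume that #{x ∈ X : Ht_X(x) ≤ B} ∼ c_X·B^α·(log B)^{β_X} and #{y ∈ Y : Ht_Y(y) ≤ B} ∼ c_Y·B^α·(log B)^{β_Y} as B → ∞. Then #{(x,y) ∈ X × Y : Ht_X(x)·Ht_Y(y) ≤ B} ∼ Β(β_Y+1, β_X+1)·c_X·c_Y·α·B^α·(log B)^{β_X+β_Y+1} as B → ∞, where Β denotes the Euler beta function. -/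
open Filter Real

/-- The Euler beta function `Β(z₁, z₂) = ∫₀¹ t^{z₁−1} (1−t)^{z₂−1} dt`. -/
noncomputable def eulerBeta (z₁ z₂ : ℝ) : ℝ :=
  ∫ t in (0:ℝ)..1, t ^ (z₁ - 1) * (1 - t) ^ (z₂ - 1)

section

open MeasureTheory Set Topology

theorem intervalIntegrable_rpow_mul_one_sub_rpow {a b : ℝ} (ha : -1 < a) (hb : 0 ≤ b) :
    IntervalIntegrable (fun s : ℝ => s ^ b * (1 - s) ^ a) volume 0 1 := by
  have h := (intervalIntegral.intervalIntegrable_rpow' (a := 0) (b := 1) ha).comp_sub_left 1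
  simp only [sub_zero, sub_self] at h
  exact h.symm.continuousOn_mul (continuous_id.rpow_const fun _ => Or.inr hb).continuousOn

theorem eulerBeta_pos {a b : ℝ} (ha : -1 < a) (hb : 0 ≤ b) :
    0 < eulerBeta (b + 1) (a + 1) := by
  unfold eulerBeta
  simp only [add_sub_cancel_right]
  refine intervalIntegral.intervalIntegral_pos_of_pos_on
    (intervalIntegrable_rpow_mul_one_sub_rpow ha hb) (fun s hs => ?_) one_pos
  have h1 : 0 < 1 - s := by linarith [hs.2]
  have h0 : 0 < s := hs.1
  positivity

theorem tendsto_exp_mul_rpow_primitive {α b : ℝ} (hα : 0 < α) (hb : 0 ≤ b) :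
    Tendsto (fun v : ℝ => (∫ t in Ioc 0 v, α * exp (α * t) * t ^ b) / (exp (α * v) * v ^ b))
      atTop (𝓝 1) := by
  have hcont : Continuous fun t : ℝ => α * exp (α * t) * t ^ b :=
    (by fun_prop : Continuous fun t : ℝ => α * exp (α * t)).mul
      (continuous_id.rpow_const fun _ => Or.inr hb)
  have hprim (p q : ℝ) (h : p ≤ q) :
      ∫ t in Ioc p q, α * exp (α * t) = exp (α * q) - exp (α * p) := by
    rw [← intervalIntegral.integral_of_le h]
    refine intervalIntegral.integral_eq_sub_of_hasDerivAt (f := fun t => exp (α * t))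
      (fun t _ => ?_) ((by fun_prop : Continuous fun t : ℝ => α * exp (α * t)).intervalIntegrable _ _)
    simpa [mul_comm] using ((hasDerivAt_id t).const_mul α).exp
  have hsqrt : Tendsto (fun v : ℝ => √v) atTop atTop := tendsto_sqrt_atTop
  have hlow : Tendsto (fun v : ℝ => (1 - (√v)⁻¹) ^ b * (1 - exp (-(α * √v)))) atTop (𝓝 1) := by
    have h1 : Tendsto (fun v : ℝ => (1 - (√v)⁻¹) ^ b) atTop (𝓝 1) := by
      have : Tendsto (fun v : ℝ => 1 - (√v)⁻¹) atTop (𝓝 (1 - 0)) :=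
        tendsto_const_nhds.sub (tendsto_inv_atTop_zero.comp hsqrt)
      have := this.rpow_const (p := b) (Or.inr hb)
      simpa using this
    have h2 : Tendsto (fun v : ℝ => 1 - exp (-(α * √v))) atTop (𝓝 (1 - 0)) :=
      tendsto_const_nhds.sub
        (tendsto_exp_neg_atTop_nhds_zero.comp (hsqrt.const_mul_atTop hα))
    simpa using h1.mul h2
  refine tendsto_of_tendsto_of_tendsto_of_le_of_le' hlow tendsto_const_nhds ?_ ?_
  · filter_upwards [eventually_gt_atTop 1] with v hv
    have hv0 : 0 < v := by linarith
    have hs1 : 1 < √v := by rw [Real.lt_sqrt] <;> linarith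
    have hsq : √v * √v = v := Real.mul_self_sqrt hv0.le
    have hsv : √v < v := by nlinarith
    rw [le_div_iff₀ (by positivity)]
    calc (1 - (√v)⁻¹) ^ b * (1 - exp (-(α * √v))) * (exp (α * v) * v ^ b)
        = (exp (α * v) - exp (α * (v - √v))) * (v - √v) ^ b := by
          have e1 : v - √v = (1 - (√v)⁻¹) * v := by
            have : (√v)⁻¹ * v = √v := by
              rw [inv_mul_eq_div, div_eq_iff (by positivity), hsq]
            rw [sub_mul, this, one_mul]
          have e2 : (v - √v) ^ b = (1 - (√v)⁻¹) ^ b * v ^ b := by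
            rw [e1, Real.mul_rpow _ hv0.le]
            have := inv_le_one_of_one_le₀ hs1.le
            linarith
          have e3 : exp (α * (v - √v)) = exp (-(α * √v)) * exp (α * v) := by
            rw [← Real.exp_add]; ring_nf
          rw [e2, e3]; ring
      _ = ∫ t in Ioc (v - √v) v, α * exp (α * t) * (v - √v) ^ b := by
          rw [integral_mul_const, hprim _ _ (by linarith [Real.sqrt_nonneg v])]
      _ ≤ ∫ t in Ioc (v - √v) v, α * exp (α * t) * t ^ b := by
          refine setIntegral_mono_on (Continuous.integrableOn_Ioc (by fun_prop))
            hcont.integrableOn_Ioc measurableSet_Ioc fun t ht => ?_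
          have := Real.rpow_le_rpow (by linarith) ht.1.le hb
          gcongr
      _ ≤ ∫ t in Ioc 0 v, α * exp (α * t) * t ^ b := by
          refine setIntegral_mono_set hcont.integrableOn_Ioc ?_
            (Ioc_subset_Ioc_left (by linarith)).eventuallyLE
          refine (ae_restrict_iff' measurableSet_Ioc).2 (ae_of_all _ fun t ht => ?_)
          have : 0 < t := ht.1
          simp only [Pi.zero_apply]
          positivity
  · filter_upwards [eventually_gt_atTop 0] with v hv
    rw [div_le_one (by positivity)]
    calc ∫ t in Ioc 0 v, α * exp (α * t) * t ^ b
        ≤ ∫ t in Ioc 0 v, α * exp (α * t) * v ^ b := by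
          refine setIntegral_mono_on hcont.integrableOn_Ioc
            (Continuous.integrableOn_Ioc (by fun_prop)) measurableSet_Ioc fun t ht => ?_
          have := Real.rpow_le_rpow ht.1.le ht.2 hb
          gcongr
      _ = (exp (α * v) - exp (α * 0)) * v ^ b := by
          rw [integral_mul_const, hprim _ _ hv.le]
      _ ≤ exp (α * v) * v ^ b := by
          gcongr
          linarith [Real.exp_pos (α * 0)]

theorem integrableOn_comp_sub_mul_rpow {f : ℝ → ℝ} {b u₀ : ℝ} (hb : 0 ≤ b) (hf : Measurable f)
    (hzero : ∀ u < u₀, f u = 0) (hbdd : ∀ M, ∃ C, ∀ u ≤ M, |f u| ≤ C) (L : ℝ) :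
    IntegrableOn (fun t => f (L - t) * t ^ b) (Ioi 0) := by
  have hb' : Continuous fun t : ℝ => t ^ b := continuous_id.rpow_const fun _ => Or.inr hb
  obtain ⟨C, hC⟩ := hbdd L
  have h1 : IntegrableOn (fun t => f (L - t) * t ^ b) (Ioc 0 (L - u₀)) := by
    refine Measure.integrableOn_of_bounded (M := C * (L - u₀) ^ b) (by simp)
      ((hf.comp (measurable_const.sub measurable_id)).mul hb'.measurable).aestronglyMeasurable ?_
    refine (ae_restrict_iff' measurableSet_Ioc).2 (ae_of_all _ fun t ht => ?_)
    have h2 := hC (L - t) (by linarith [ht.1])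
    have h3 := Real.rpow_le_rpow ht.1.le ht.2 hb
    have h4 : 0 ≤ t ^ b := Real.rpow_nonneg ht.1.le _
    rw [norm_mul, Real.norm_eq_abs, Real.norm_eq_abs, abs_of_nonneg h4]
    have := (abs_nonneg _).trans h2
    gcongr
  refine h1.of_forall_sdiff_eq_zero measurableSet_Ioi fun t ht => ?_
  have : L - u₀ < t := by
    by_contra h
    exact ht.2 ⟨ht.1, not_lt.1 h⟩
  simp [hzero (L - t) (by linarith)]

theorem exists_bound_mul_rpow {f : ℝ → ℝ} {a c : ℝ} (hbdd : ∀ M, ∃ C, ∀ u ≤ M, |f u| ≤ C)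
    (hasym : Tendsto (fun u => f u / u ^ a) atTop (𝓝 c)) :
    ∃ C, ∀ u > 1, |f u| ≤ C * u ^ a := by
  have h1 : ∀ᶠ u in atTop, |f u / u ^ a| < |c| + 1 :=
    hasym.abs.eventually_lt_const (by linarith)
  obtain ⟨M, hM⟩ := eventually_atTop.1 h1
  obtain ⟨C, hC⟩ := hbdd M
  refine ⟨max (|c| + 1) (C * M ^ |a|), fun u hu => ?_⟩
  have hu0 : 0 < u := by linarith
  have hua : 0 < u ^ a := by positivity
  rcases le_total M u with h | h
  · have := (hM u h).le
    rw [abs_div, abs_of_pos hua, div_le_iff₀ hua] at this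
    exact this.trans (by gcongr; exact le_max_left _ _)
  · have h2 := hC u h
    have hC0 : 0 ≤ C := (abs_nonneg _).trans h2
    have h3 : u ^ (-a) ≤ M ^ |a| :=
      (Real.rpow_le_rpow_of_exponent_le hu.le (neg_le_abs a)).trans
        (Real.rpow_le_rpow hu0.le h (abs_nonneg a))
    calc |f u| ≤ C := h2
      _ = C * u ^ (-a) * u ^ a := by
          rw [mul_assoc, ← Real.rpow_add hu0]; simp
      _ ≤ C * M ^ |a| * u ^ a := by gcongr
      _ ≤ _ := by gcongr; exact le_max_right _ _

theorem tendsto_one_sub_div_rpow (p b : ℝ) :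
    Tendsto (fun L : ℝ => (L - p) ^ b / L ^ b) atTop (𝓝 1) := by
  have h1 : Tendsto (fun L : ℝ => 1 - p * L⁻¹) atTop (𝓝 (1 - p * 0)) :=
    tendsto_const_nhds.sub (tendsto_inv_atTop_zero.const_mul p)
  have h2 := h1.rpow_const (p := b) (Or.inl (by simp))
  simp only [mul_zero, sub_zero, Real.one_rpow] at h2
  refine h2.congr' ?_
  filter_upwards [eventually_gt_atTop 0, eventually_gt_atTop p] with L hL hp
  rw [← Real.div_rpow (by linarith) hL.le]
  congr 1
  field_simp

theorem tendsto_convolution_rpow_of_support_Ioi {f : ℝ → ℝ} {a b c C : ℝ} (ha : -1 < a)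
    (hb : 0 ≤ b) (hf : Measurable f) (hzero : ∀ u ≤ 1, f u = 0) (hbound : ∀ u > 1, |f u| ≤ C * u ^ a)
    (hasym : Tendsto (fun u => f u / u ^ a) atTop (𝓝 c)) :
    Tendsto (fun L => (∫ t in Ioi 0, f (L - t) * t ^ b) / L ^ (a + b + 1)) atTop
      (𝓝 (c * eulerBeta (b + 1) (a + 1))) := by
  have hb' : Continuous fun t : ℝ => t ^ b := continuous_id.rpow_const fun _ => Or.inr hb
  have hC : 0 ≤ C := by
    have := (abs_nonneg _).trans (hbound 2 (by norm_num))
    exact nonneg_of_mul_nonneg_left this (by positivity)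
  have hlim : c * eulerBeta (b + 1) (a + 1) =
      ∫ s in Ioi (0 : ℝ), (Ioo 0 1).indicator (fun s => c * (s ^ b * (1 - s) ^ a)) s := by
    rw [setIntegral_indicator measurableSet_Ioo, integral_const_mul,
      inter_eq_self_of_subset_right fun s hs => hs.1, ← integral_Ioc_eq_integral_Ioo,
      ← intervalIntegral.integral_of_le zero_le_one]
    simp [eulerBeta]
  rw [hlim]
  have hscale : ∀ᶠ L in atTop, (∫ s in Ioi (0 : ℝ), f (L - L * s) / L ^ a * s ^ b) =
      (∫ t in Ioi 0, f (L - t) * t ^ b) / L ^ (a + b + 1) := by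
    filter_upwards [eventually_gt_atTop 0] with L hL
    have h := integral_comp_mul_left_Ioi (fun t => f (L - t) * t ^ b) 0 hL
    rw [mul_zero, smul_eq_mul, inv_mul_eq_div, eq_div_iff hL.ne'] at h
    rw [← h, Real.rpow_add_one hL.ne', Real.rpow_add hL, mul_div_mul_right _ _ hL.ne',
      ← integral_div]
    refine setIntegral_congr_fun measurableSet_Ioi fun s hs => ?_
    rw [Real.mul_rpow hL.le (le_of_lt hs)]
    have h1 : L ^ a ≠ 0 := by positivity
    have h2 : L ^ b ≠ 0 := by positivity
    field_simp
  refine Tendsto.congr' hscale ?_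
  refine tendsto_integral_filter_of_dominated_convergence
    ((Ioo 0 1).indicator fun s => C * (s ^ b * (1 - s) ^ a)) ?_ ?_ ?_ ?_
  · refine Eventually.of_forall fun L => Measurable.aestronglyMeasurable ?_
    exact ((hf.comp (by fun_prop)).div_const _).mul hb'.measurable
  · filter_upwards [eventually_gt_atTop 0] with L hL
    refine (ae_restrict_iff' measurableSet_Ioi).2 (ae_of_all _ fun s hs => ?_)
    have hs0 : 0 < s := hs
    by_cases h : 1 < L - L * s
    · have hs1 : s < 1 := by
        by_contra h'
        nlinarith
      rw [indicator_of_mem (show s ∈ Ioo 0 1 from ⟨hs0, hs1⟩)]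
      have h1s : 0 < 1 - s := by linarith
      have h2 := hbound _ h
      rw [show L - L * s = L * (1 - s) by ring, Real.mul_rpow hL.le h1s.le] at h2
      rw [norm_mul, norm_div, Real.norm_eq_abs, Real.norm_eq_abs, Real.norm_eq_abs,
        abs_of_pos (by positivity : 0 < L ^ a), abs_of_pos (by positivity : 0 < s ^ b),
        show L - L * s = L * (1 - s) by ring]
      calc |f (L * (1 - s))| / L ^ a * s ^ b ≤ C * (L ^ a * (1 - s) ^ a) / L ^ a * s ^ b := by gcongr
        _ = C * (s ^ b * (1 - s) ^ a) := by field_simp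
    · rw [hzero _ (not_lt.1 h)]
      simp only [zero_div, zero_mul, norm_zero]
      refine indicator_nonneg (fun t ht => ?_) s
      have : 0 < t := ht.1
      have : 0 < 1 - t := by linarith [ht.2]
      positivity
  · refine IntegrableOn.integrable ?_
    refine Integrable.integrableOn ?_
    rw [integrable_indicator_iff measurableSet_Ioo]
    have := (intervalIntegrable_rpow_mul_one_sub_rpow ha hb).const_mul C
    rw [intervalIntegrable_iff_integrableOn_Ioo_of_le zero_le_one] at this
    exact this
  · refine (ae_restrict_iff' measurableSet_Ioi).2 (ae_of_all _ fun s hs => ?_)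
    have hs0 : 0 < s := hs
    by_cases h : s < 1
    · rw [indicator_of_mem (show s ∈ Ioo 0 1 from ⟨hs0, h⟩)]
      have h1s : 0 < 1 - s := by linarith
      have h2 : Tendsto (fun L : ℝ => L * (1 - s)) atTop atTop := tendsto_id.atTop_mul_const h1s
      have h3 := ((hasym.comp h2).mul_const ((1 - s) ^ a)).mul_const (s ^ b)
      rw [show c * (s ^ b * (1 - s) ^ a) = c * (1 - s) ^ a * s ^ b by ring]
      refine h3.congr' ?_
      filter_upwards [eventually_gt_atTop 0] with L hL
      simp only [Function.comp]
      rw [show L - L * s = L * (1 - s) by ring, Real.mul_rpow hL.le h1s.le]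
      field_simp
    · rw [indicator_of_notMem (fun h' : s ∈ Ioo 0 1 => h h'.2)]
      refine tendsto_const_nhds.congr' ?_
      filter_upwards [eventually_gt_atTop 0] with L hL
      rw [hzero (L - L * s) (by nlinarith)]
      simp

theorem tendsto_convolution_rpow_of_support_Icc {f : ℝ → ℝ} {a b C u₀ : ℝ} (ha : -1 < a)
    (hb : 0 ≤ b) (hu₀ : u₀ ≤ 0) (hlow : ∀ u < u₀, f u = 0) (hhigh : ∀ u > 1, f u = 0)
    (hC : ∀ u, |f u| ≤ C) :
    Tendsto (fun L => (∫ t in Ioi 0, f (L - t) * t ^ b) / L ^ (a + b + 1)) atTop (𝓝 0) := by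
  have hlim : Tendsto (fun L : ℝ => C * (1 - u₀) * (((L - u₀) ^ b / L ^ b) * L ^ (-(a + 1))))
      atTop (𝓝 0) := by
    have := ((tendsto_one_sub_div_rpow u₀ b).mul
      (tendsto_rpow_neg_atTop (by linarith : 0 < a + 1))).const_mul (C * (1 - u₀))
    simpa using this
  refine squeeze_zero_norm' ?_ hlim
  filter_upwards [eventually_gt_atTop 1] with L hL
  have hL0 : 0 < L := by linarith
  have hC0 : 0 ≤ C := (abs_nonneg _).trans (hC 0)
  have hset : ∫ t in Ioi 0, f (L - t) * t ^ b = ∫ t in Icc (L - 1) (L - u₀), f (L - t) * t ^ b := by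
    refine setIntegral_eq_of_subset_of_forall_sdiff_eq_zero measurableSet_Ioi
      (fun t ht => lt_of_lt_of_le (by linarith) ht.1) fun t ht => ?_
    rcases lt_or_ge t (L - 1) with h | h
    · simp [hhigh (L - t) (by linarith)]
    · have : L - u₀ < t := by
        by_contra h'
        exact ht.2 ⟨h, not_lt.1 h'⟩
      simp [hlow (L - t) (by linarith)]
  have hnorm : ‖∫ t in Icc (L - 1) (L - u₀), f (L - t) * t ^ b‖ ≤
      C * (L - u₀) ^ b * (1 - u₀) := by
    have := norm_setIntegral_le_of_norm_le_const (μ := volume) (s := Icc (L - 1) (L - u₀))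
      (f := fun t => f (L - t) * t ^ b) (C := C * (L - u₀) ^ b) (by simp) (fun t ht => ?_)
    · rw [Real.volume_real_Icc_of_le (by linarith)] at this
      convert this using 2
      ring
    · have ht0 : 0 < t := by linarith [ht.1]
      have h3 := Real.rpow_le_rpow ht0.le ht.2 hb
      rw [norm_mul, Real.norm_eq_abs, Real.norm_eq_abs, abs_of_pos (by positivity : 0 < t ^ b)]
      have := hC (L - t)
      gcongr
  rw [hset, norm_div, Real.norm_eq_abs (L ^ _), abs_of_pos (by positivity : 0 < L ^ (a + b + 1)),
    div_le_iff₀ (by positivity)]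
  refine hnorm.trans_eq ?_
  rw [show a + b + 1 = b + (a + 1) by ring, Real.rpow_add hL0, Real.rpow_neg hL0.le]
  have h1 : L ^ b ≠ 0 := by positivity
  have h2 : L ^ (a + 1) ≠ 0 := by positivity
  field_simp

theorem tendsto_convolution_rpow {f : ℝ → ℝ} {a b c u₀ : ℝ} (ha : -1 < a) (hb : 0 ≤ b)
    (hu₀ : u₀ ≤ 0) (hf : Measurable f) (hzero : ∀ u < u₀, f u = 0)
    (hbdd : ∀ M, ∃ C, ∀ u ≤ M, |f u| ≤ C)
    (hasym : Tendsto (fun u => f u / u ^ a) atTop (𝓝 c)) :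
    Tendsto (fun L => (∫ t in Ioi 0, f (L - t) * t ^ b) / L ^ (a + b + 1)) atTop
      (𝓝 (c * eulerBeta (b + 1) (a + 1))) := by
  have habs (s : Set ℝ) (u : ℝ) : |s.indicator f u| ≤ |f u| := by
    by_cases h : u ∈ s <;> simp [h]
  have hsplit (L : ℝ) : (∫ t in Ioi 0, f (L - t) * t ^ b) =
      (∫ t in Ioi 0, (Ioi 1).indicator f (L - t) * t ^ b) +
        ∫ t in Ioi 0, (Iic 1).indicator f (L - t) * t ^ b := by
    have hint (s : Set ℝ) (hs : MeasurableSet s) :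
        IntegrableOn (fun t => s.indicator f (L - t) * t ^ b) (Ioi 0) := by
      refine integrableOn_comp_sub_mul_rpow hb (hf.indicator hs) (u₀ := u₀) (fun u hu => ?_)
        (fun M => ?_) L
      · exact indicator_apply_eq_zero.2 fun _ => hzero u hu
      · obtain ⟨C, hC⟩ := hbdd M
        exact ⟨C, fun u hu => (habs s u).trans (hC u hu)⟩
    rw [← integral_add (hint _ measurableSet_Ioi) (hint _ measurableSet_Iic)]
    congr 1 with t
    rw [← add_mul]
    congr 1
    by_cases h : 1 < L - t
    · simp [h, h.not_ge]
    · simp [h, not_lt.1 h]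
  simp only [hsplit, add_div]
  rw [← add_zero (c * _)]
  obtain ⟨C, hC⟩ := exists_bound_mul_rpow hbdd hasym
  obtain ⟨C', hC'⟩ := hbdd 1
  refine Tendsto.add ?_ ?_
  · refine tendsto_convolution_rpow_of_support_Ioi (C := C) ha hb (hf.indicator measurableSet_Ioi)
      (fun u hu => by simp [hu]) (fun u hu => (habs _ u).trans (hC u hu)) (hasym.congr' ?_)
    filter_upwards [eventually_gt_atTop 1] with u hu
    simp [hu]
  · refine tendsto_convolution_rpow_of_support_Icc (C := C') (u₀ := u₀) ha hb hu₀
      (fun u hu => indicator_apply_eq_zero.2 fun _ => hzero u hu) (fun u hu => by simp [hu])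
      fun u => ?_
    by_cases h : u ≤ 1
    · exact (habs _ u).trans (hC' u h)
    · have := (abs_nonneg _).trans (hC' 1 le_rfl)
      simpa [h] using this

theorem abs_sub_le_of_tendsto_div {G G₀ E : ℝ → ℝ} {c : ℝ} (hc : 0 < c) (hG : Monotone G)
    (hG_nonneg : ∀ v, 0 ≤ G v) (hG₀ : Monotone G₀) (hG₀_nonneg : ∀ v, 0 ≤ G₀ v)
    (hE : ∀ᶠ v in atTop, 0 < E v) (hGE : Tendsto (fun v => G v / (c * E v)) atTop (𝓝 1))
    (hG₀E : Tendsto (fun v => G₀ v / E v) atTop (𝓝 1)) {ε : ℝ} (hε : 0 < ε) :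
    ∃ C, ∀ v, |G v - c * G₀ v| ≤ ε * G₀ v + C := by
  have hratio : Tendsto (fun v => G v / (c * E v) * c / (G₀ v / E v)) atTop (𝓝 (1 * c / 1)) :=
    (hGE.mul_const c).div hG₀E one_ne_zero
  rw [one_mul, div_one] at hratio
  have hev : ∀ᶠ v in atTop, |G v - c * G₀ v| ≤ ε * G₀ v := by
    filter_upwards [hE, hG₀E.eventually_const_lt one_pos, Metric.tendsto_nhds.1 hratio ε hε]
      with v hv h1 h2
    have hpos : 0 < G₀ v := (div_pos_iff_of_pos_right hv).1 h1
    have h3 : G v / (c * E v) * c / (G₀ v / E v) = G v / G₀ v := by field_simp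
    have h4 : G v - c * G₀ v = (G v / G₀ v - c) * G₀ v := by field_simp
    rw [h3, Real.dist_eq] at h2
    rw [h4, abs_mul, abs_of_pos hpos]
    gcongr
  obtain ⟨M, hM⟩ := eventually_atTop.1 hev
  have hC : 0 ≤ G M + c * G₀ M := add_nonneg (hG_nonneg M) (mul_nonneg hc.le (hG₀_nonneg M))
  refine ⟨G M + c * G₀ M, fun v => ?_⟩
  rcases le_total M v with h | h
  · linarith [hM v h]
  · have h1 := hG h
    have h2 := mul_le_mul_of_nonneg_left (hG₀ h) hc.le
    have h3 := hG_nonneg v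
    have h4 := mul_nonneg hc.le (hG₀_nonneg v)
    have h5 := mul_nonneg hε.le (hG₀_nonneg v)
    rw [abs_le]
    constructor <;> linarith

section Counting

variable {X Y : Type*}

theorem monotone_ncard_sublevel {u : X → ℝ} (hu : ∀ L : ℝ, {x | u x ≤ L}.Finite) :
    Monotone fun L : ℝ => ({x | u x ≤ L}.ncard : ℝ) := fun _ M h =>
  Nat.cast_le.2 (ncard_le_ncard (fun _ hx => le_trans hx h) (hu M))

theorem exists_le_of_finite_sublevel {u : X → ℝ} (hu : ∀ L : ℝ, {x | u x ≤ L}.Finite) :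
    ∃ u₀ ≤ 0, ∀ x, u₀ ≤ u x := by
  obtain ⟨m, hm⟩ := ((hu 0).image u).bddBelow
  refine ⟨min m 0, min_le_right _ _, fun x => ?_⟩
  rcases le_total (u x) 0 with h | h
  · exact (min_le_left _ _).trans (hm ⟨x, h, rfl⟩)
  · exact (min_le_right _ _).trans h

theorem ncard_add_le_eq_sum {u : X → ℝ} {v : Y → ℝ} (hv : ∀ L : ℝ, {y | v y ≤ L}.Finite)
    {L : ℝ} {T : Finset X} (hT : ∀ x y, u x + v y ≤ L → x ∈ T) :
    {p : X × Y | u p.1 + v p.2 ≤ L}.ncard = ∑ x ∈ T, {y | v y ≤ L - u x}.ncard := by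
  have h : {p : X × Y | u p.1 + v p.2 ≤ L} = Equiv.sigmaEquivProd X Y ''
      (T.sigma fun x => (hv (L - u x)).toFinset : Finset (Σ _ : X, Y)) := by
    ext ⟨x, y⟩
    simp only [mem_ofPred_eq, mem_image, Finset.mem_coe, Finset.mem_sigma, Finite.mem_toFinset]
    constructor
    · exact fun h => ⟨⟨x, y⟩, ⟨hT x y h, by dsimp only; linarith⟩, rfl⟩
    · rintro ⟨⟨x', y'⟩, ⟨-, h⟩, he⟩
      simp only [Equiv.sigmaEquivProd_apply, Prod.mk.injEq] at he
      obtain ⟨rfl, rfl⟩ := he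
      dsimp only at h
      linarith
  rw [h, ncard_image_of_injective _ (Equiv.injective _), ncard_coe_finset, Finset.card_sigma]
  exact Finset.sum_congr rfl fun x _ => (ncard_eq_toFinset_card _ _).symm

theorem sum_setIntegral_eq_setIntegral_ncard_mul {u : X → ℝ} {w : ℝ → ℝ} (hw : Continuous w)
    {L : ℝ} {T : Finset X} (hT : ∀ x, u x ≤ L → x ∈ T) :
    ∑ x ∈ T, ∫ t in Ioc 0 (L - u x), w t =
      ∫ t in Ioi 0, ({x | u x ≤ L - t}.ncard : ℝ) * w t := by
  have h (x : X) : ∫ t in Ioc 0 (L - u x), w t =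
      ∫ t in Ioi 0, (Iic (L - u x)).indicator w t := by
    rw [setIntegral_indicator measurableSet_Iic, Ioi_inter_Iic]
  simp only [h]
  rw [← integral_finsetSum]
  · refine setIntegral_congr_fun measurableSet_Ioi fun t ht => ?_
    have ht0 : 0 < t := ht
    have hcard : {x | u x ≤ L - t} = (T.filter fun x => t ≤ L - u x : Finset X) := by
      ext x
      simp only [mem_ofPred_eq, Finset.coe_filter]
      exact ⟨fun hx => ⟨hT x (by linarith), by linarith⟩, fun hx => by linarith [hx.2]⟩
    simp only [hcard, ncard_coe_finset, indicator_apply, mem_Iic]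
    rw [← Finset.sum_filter, Finset.sum_const, nsmul_eq_mul]
  · intro x _
    rw [integrable_indicator_iff measurableSet_Iic, IntegrableOn,
      Measure.restrict_restrict measurableSet_Iic, inter_comm, Ioi_inter_Iic]
    exact hw.integrableOn_Ioc

theorem tendsto_sum_primitive {u : X → ℝ} (hu : ∀ L : ℝ, {x | u x ≤ L}.Finite)
    {c α a b : ℝ} (hc : 0 < c) (ha : -1 < a) (hb : 0 ≤ b) {T : ℝ → Finset X}
    (hT : ∀ L x, u x ≤ L → x ∈ T L)
    (hX : Tendsto (fun L : ℝ => ({x | u x ≤ L}.ncard : ℝ) / (c * exp (α * L) * L ^ a))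
      atTop (𝓝 1)) :
    Tendsto (fun L => (∑ x ∈ T L, ∫ t in Ioc 0 (L - u x), α * exp (α * t) * t ^ b) /
      (exp (α * L) * L ^ (a + b + 1))) atTop (𝓝 (α * (c * eulerBeta (b + 1) (a + 1)))) := by
  have hw : Continuous fun t : ℝ => α * exp (α * t) * t ^ b :=
    (by fun_prop : Continuous fun t : ℝ => α * exp (α * t)).mul
      (continuous_id.rpow_const fun _ => Or.inr hb)
  obtain ⟨u₀, hu₀, hle⟩ := exists_le_of_finite_sublevel hu
  have hmono := monotone_ncard_sublevel hu
  have hzero : ∀ L < u₀, ({x | u x ≤ L}.ncard : ℝ) = 0 := fun L hL => by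
    rw [show {x | u x ≤ L} = ∅ from eq_empty_of_forall_notMem fun x hx =>
      absurd (hle x) (not_le.2 (lt_of_le_of_lt hx hL))]
    simp
  have hmeas : Measurable fun L : ℝ => exp (-(α * L)) * ({x | u x ≤ L}.ncard : ℝ) :=
    (by fun_prop : Measurable fun L : ℝ => exp (-(α * L))).mul hmono.measurable
  have hmain := (tendsto_convolution_rpow (c := c) (u₀ := u₀) ha hb hu₀ hmeas
    (fun L hL => by simp [hzero L hL]) (fun M => ?_) ?_).const_mul α
  · refine hmain.congr fun L => ?_
    rw [sum_setIntegral_eq_setIntegral_ncard_mul hw (hT L)]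
    have : ∫ t in Ioi 0, ({x | u x ≤ L - t}.ncard : ℝ) * (α * exp (α * t) * t ^ b) =
        exp (α * L) * (α * ∫ t in Ioi 0,
          exp (-(α * (L - t))) * ({x | u x ≤ L - t}.ncard : ℝ) * t ^ b) := by
      rw [← integral_const_mul, ← integral_const_mul]
      congr 1 with t
      rw [show α * t = α * L + -(α * (L - t)) by ring, Real.exp_add]
      ring
    rw [this, mul_div_mul_left _ _ (Real.exp_ne_zero _), mul_div_assoc]
  · obtain ⟨C, hC⟩ := (isCompact_Icc (a := u₀) (b := M)).exists_bound_of_continuousOn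
      (f := fun L : ℝ => exp (-(α * L))) (by fun_prop)
    refine ⟨max C 0 * ({x | u x ≤ M}.ncard : ℝ), fun L hL => ?_⟩
    rcases lt_or_ge L u₀ with h | h
    · rw [hzero L h, mul_zero, abs_zero]
      positivity
    · rw [abs_mul, Nat.abs_cast]
      exact mul_le_mul ((hC L ⟨h, hL⟩).trans (le_max_left _ _)) (hmono hL) (by positivity)
        (by positivity)
  · have := hX.mul_const c
    rw [one_mul] at this
    refine this.congr fun L => ?_
    rw [Real.exp_neg]
    field_simp

theorem tendsto_ncard_sub_div_zero {u : X → ℝ} {c α a b : ℝ} (hc : 0 < c) (hb : 0 ≤ b) (p : ℝ)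
    (hX : Tendsto (fun L : ℝ => ({x | u x ≤ L}.ncard : ℝ) / (c * exp (α * L) * L ^ a))
      atTop (𝓝 1)) :
    Tendsto (fun L : ℝ => ({x | u x ≤ L - p}.ncard : ℝ) / (exp (α * L) * L ^ (a + b + 1)))
      atTop (𝓝 0) := by
  have h1 : Tendsto (fun L : ℝ => L - p) atTop atTop := tendsto_atTop_add_const_right _ _ tendsto_id
  have h2 := (((hX.comp h1).mul (tendsto_one_sub_div_rpow p a)).mul
    (tendsto_rpow_neg_atTop (by linarith : 0 < b + 1))).const_mul (c * exp (-(α * p)))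
  rw [mul_zero, mul_zero] at h2
  refine h2.congr' ?_
  filter_upwards [eventually_gt_atTop 0, eventually_gt_atTop p] with L hL hp
  have h3 : (L - p) ^ a ≠ 0 := (Real.rpow_pos_of_pos (by linarith) _).ne'
  simp only [Function.comp]
  rw [show α * (L - p) = α * L + -(α * p) by ring, Real.exp_add,
    show a + b + 1 = a + (b + 1) by ring, Real.rpow_add hL, Real.rpow_neg hL.le]
  field_simp

theorem tendsto_ncard_add_le {u : X → ℝ} {v : Y → ℝ} (hu : ∀ L : ℝ, {x | u x ≤ L}.Finite)
    (hv : ∀ L : ℝ, {y | v y ≤ L}.Finite) {c d α a b : ℝ} (hc : 0 < c) (hd : 0 < d) (hα : 0 < α)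
    (ha : -1 < a) (hb : 0 ≤ b)
    (hX : Tendsto (fun L : ℝ => ({x | u x ≤ L}.ncard : ℝ) / (c * exp (α * L) * L ^ a))
      atTop (𝓝 1))
    (hY : Tendsto (fun L : ℝ => ({y | v y ≤ L}.ncard : ℝ) / (d * exp (α * L) * L ^ b))
      atTop (𝓝 1)) :
    Tendsto (fun L : ℝ => ({p : X × Y | u p.1 + v p.2 ≤ L}.ncard : ℝ) /
      (exp (α * L) * L ^ (a + b + 1))) atTop
      (𝓝 (d * (α * (c * eulerBeta (b + 1) (a + 1))))) := by
  obtain ⟨v₀, hv₀, hle⟩ := exists_le_of_finite_sublevel hv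
  set T : ℝ → Finset X := fun L => (hu (L - v₀)).toFinset with hT
  set G₀ : ℝ → ℝ := fun s => ∫ t in Ioc 0 s, α * exp (α * t) * t ^ b with hG₀
  set D : ℝ → ℝ := fun L => exp (α * L) * L ^ (a + b + 1) with hD
  have hw : Continuous fun t : ℝ => α * exp (α * t) * t ^ b :=
    (by fun_prop : Continuous fun t : ℝ => α * exp (α * t)).mul
      (continuous_id.rpow_const fun _ => Or.inr hb)
  have hw_nonneg (s : ℝ) : ∀ t ∈ Ioc 0 s, 0 ≤ α * exp (α * t) * t ^ b := fun t ht => by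
    have : 0 < t := ht.1
    positivity
  have hG₀_nonneg (s : ℝ) : 0 ≤ G₀ s := setIntegral_nonneg measurableSet_Ioc (hw_nonneg s)
  have hG₀_mono : Monotone G₀ := fun r s h =>
    setIntegral_mono_set hw.integrableOn_Ioc
      ((ae_restrict_iff' measurableSet_Ioc).2 (ae_of_all _ (hw_nonneg s)))
      (Ioc_subset_Ioc_right h).eventuallyLE
  have hS := tendsto_sum_primitive hu hc ha hb (T := T) (α := α)
    (fun L x hx => by simp only [hT, Finite.mem_toFinset, mem_ofPred_eq]; linarith) hX
  have hR := tendsto_ncard_sub_div_zero hc hb v₀ hX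
  have hDpos : ∀ᶠ L in atTop, 0 < D L := by
    filter_upwards [eventually_gt_atTop 0] with L hL
    positivity
  have hN (L : ℝ) : ({p : X × Y | u p.1 + v p.2 ≤ L}.ncard : ℝ) =
      ∑ x ∈ T L, ({y | v y ≤ L - u x}.ncard : ℝ) := by
    rw [ncard_add_le_eq_sum hv (T := T L) fun x y hxy => ?_, Nat.cast_sum]
    simp only [hT, Finite.mem_toFinset, mem_ofPred_eq]
    linarith [hle y]
  have herr {ε : ℝ} (hε : 0 < ε) : ∃ C, ∀ L,
      |({p : X × Y | u p.1 + v p.2 ≤ L}.ncard : ℝ) - d * ∑ x ∈ T L, G₀ (L - u x)| ≤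
        ε * (∑ x ∈ T L, G₀ (L - u x)) + C * ({x | u x ≤ L - v₀}.ncard : ℝ) := by
    obtain ⟨C, h⟩ := abs_sub_le_of_tendsto_div hd (monotone_ncard_sublevel hv)
      (fun _ => Nat.cast_nonneg _) hG₀_mono hG₀_nonneg (E := fun s => exp (α * s) * s ^ b)
      (by filter_upwards [eventually_gt_atTop 0] with s hs; positivity)
      (by simpa only [mul_assoc] using hY) (tendsto_exp_mul_rpow_primitive hα hb) hε
    refine ⟨C, fun L => ?_⟩
    rw [hN, Finset.mul_sum, ← Finset.sum_sub_distrib]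
    refine (Finset.abs_sum_le_sum_abs _ _).trans
      ((Finset.sum_le_sum fun x _ => h (L - u x)).trans_eq ?_)
    rw [Finset.sum_add_distrib, Finset.sum_const, ← Finset.mul_sum, nsmul_eq_mul, mul_comm C,
      ncard_eq_toFinset_card _ (hu (L - v₀))]
  have hdiff : Tendsto (fun L => ({p : X × Y | u p.1 + v p.2 ≤ L}.ncard : ℝ) / D L -
      d * ((∑ x ∈ T L, G₀ (L - u x)) / D L)) atTop (𝓝 0) := by
    rw [Metric.tendsto_nhds]
    intro δ hδ
    set σ := α * (c * eulerBeta (b + 1) (a + 1))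
    have hσ : 0 < σ := mul_pos hα (mul_pos hc (eulerBeta_pos ha hb))
    obtain ⟨C, hC⟩ := herr (div_pos hδ (by linarith : 0 < 2 * σ))
    have hlim := (hS.const_mul (δ / (2 * σ))).add (hR.const_mul C)
    have hval : δ / (2 * σ) * σ + C * 0 < δ := by
      rw [mul_zero, add_zero, div_mul_eq_mul_div, mul_div_mul_right _ _ hσ.ne']
      linarith
    filter_upwards [hlim.eventually_lt_const hval, hDpos] with L hL hDL
    rw [Real.dist_eq, sub_zero, ← mul_div_assoc, ← sub_div, abs_div, abs_of_pos hDL]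
    refine lt_of_le_of_lt ?_ hL
    rw [← mul_div_assoc, ← mul_div_assoc, ← add_div]
    exact div_le_div_of_nonneg_right (hC L) hDL.le
  have := hdiff.add (hS.const_mul d)
  rw [zero_add] at this
  exact this.congr fun L => sub_add_cancel _ _

end Counting

end

/-- Product lemma, equal exponents case: if
`#{x : Ht_X x ≤ B} ∼ c_X B^α (log B)^{β_X}` and `#{y : Ht_Y y ≤ B} ∼ c_Y B^α (log B)^{β_Y}`
as `B → ∞`, with `c_X, c_Y, α > 0`, `β_Y ≥ 0`, `β_X > −1`, then
`#{(x,y) : Ht_X x · Ht_Y y ≤ B} ∼ Β(β_Y+1, β_X+1) c_X c_Y α B^α (log B)^{β_X+β_Y+1}`. -/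
theorem stmt_0 {X Y : Type*} (HtX : X → ℝ) (HtY : Y → ℝ)
    (hHtX : ∀ x, 0 < HtX x) (hHtY : ∀ y, 0 < HtY y)
    (hXfin : ∀ B : ℝ, {x : X | HtX x ≤ B}.Finite)
    (hYfin : ∀ B : ℝ, {y : Y | HtY y ≤ B}.Finite)
    (cX cY α βX βY : ℝ) (hcX : 0 < cX) (hcY : 0 < cY) (hα : 0 < α)
    (hβY : 0 ≤ βY) (hβX : -1 < βX)
    (hX : Tendsto (fun B : ℝ =>
        ({x : X | HtX x ≤ B}.ncard : ℝ) / (cX * B ^ α * Real.log B ^ βX))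
      atTop (nhds 1))
    (hY : Tendsto (fun B : ℝ =>
        ({y : Y | HtY y ≤ B}.ncard : ℝ) / (cY * B ^ α * Real.log B ^ βY))
      atTop (nhds 1)) :
    Tendsto (fun B : ℝ =>
        ({p : X × Y | HtX p.1 * HtY p.2 ≤ B}.ncard : ℝ) /
          (eulerBeta (βY + 1) (βX + 1) * cX * cY * α * B ^ α *
            Real.log B ^ (βX + βY + 1)))
      atTop (nhds 1) := by
  have hlogX (L : ℝ) : {x | Real.log (HtX x) ≤ L} = {x | HtX x ≤ Real.exp L} := by
    ext x
    exact Real.log_le_iff_le_exp (hHtX x)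
  have hlogY (L : ℝ) : {y | Real.log (HtY y) ≤ L} = {y | HtY y ≤ Real.exp L} := by
    ext y
    exact Real.log_le_iff_le_exp (hHtY y)
  have hexp (L γ : ℝ) : Real.exp L ^ γ = Real.exp (γ * L) := by
    rw [← Real.exp_mul, mul_comm]
  have hX' := hX.comp Real.tendsto_exp_atTop
  have hY' := hY.comp Real.tendsto_exp_atTop
  simp only [Function.comp_def, Real.log_exp, hexp, ← hlogX] at hX'
  simp only [Function.comp_def, Real.log_exp, hexp, ← hlogY] at hY'
  have hmain := (tendsto_ncard_add_le (fun L => hlogX L ▸ hXfin _) (fun L => hlogY L ▸ hYfin _)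
    hcX hcY hα hβX hβY hX' hY').comp Real.tendsto_log_atTop
  have hbeta := eulerBeta_pos hβX hβY
  have hK : cY * (α * (cX * eulerBeta (βY + 1) (βX + 1))) ≠ 0 := by positivity
  have hdiv := hmain.div_const (cY * (α * (cX * eulerBeta (βY + 1) (βX + 1))))
  rw [div_self hK] at hdiv
  refine hdiv.congr' ?_
  filter_upwards [eventually_gt_atTop 0] with B hB
  have hset : {p : X × Y | Real.log (HtX p.1) + Real.log (HtY p.2) ≤ Real.log B} =
      {p : X × Y | HtX p.1 * HtY p.2 ≤ B} := by
    ext p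
    simp only [Set.mem_ofPred_eq]
    rw [← Real.log_mul (hHtX _).ne' (hHtY _).ne',
      Real.log_le_log_iff (mul_pos (hHtX _) (hHtY _)) hB]
  simp only [Function.comp_def, hset]
  rw [← hexp, Real.exp_log hB, div_div]
  congr 1
  ring
end

section
/- Let K be a field of characteristic zero and let g₄, g₆, h₆, k₆ ∈ K with g₆, h₆, k₆ nonzero, satisfying the two relations g₆² + 2h₆² + k₆² = 0 and 4g₄³ + 27h₆² + k₆² = 0. Set j = g₄³/g₆². Then the quaternion algebras (−10(1−4j), 5(8j−27) | K) and (−10, 5 | K) are isomorphic as K-algebras. -/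
open scoped Quaternion

/-- Rescaling the generators `i` and `j` by nonzero `u` and `v` identifies
`(a * u², b * v² | K)` with `(a, b | K)`. -/
def quaternionAlgebraScaleEquiv {K : Type*} [Field K] (a b : K) {u v : K}
    (hu : u ≠ 0) (hv : v ≠ 0) : ℍ[K, a * u ^ 2, b * v ^ 2] ≃ₐ[K] ℍ[K, a, b] where
  toFun x := ⟨x.re, u * x.imI, v * x.imJ, u * v * x.imK⟩
  invFun x := ⟨x.re, u⁻¹ * x.imI, v⁻¹ * x.imJ, (u * v)⁻¹ * x.imK⟩
  left_inv x := by ext <;> simp [hu, hv]; field_simp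
  right_inv x := by ext <;> simp [hu, hv]; field_simp
  map_mul' x y := by ext <;> simp <;> ring
  map_add' x y := by ext <;> simp <;> ring
  commutes' r := by ext <;> simp

/-- For a field `K` of characteristic zero and `g₄, g₆, h₆, k₆ ∈ K` with
`g₆, h₆, k₆` nonzero, satisfying `g₆² + 2h₆² + k₆² = 0` and `4g₄³ + 27h₆² + k₆² = 0`,
setting `j = g₄³/g₆²`, the quaternion algebras `(−10(1−4j), 5(8j−27) | K)` and
`(−10, 5 | K)` are isomorphic as `K`-algebras. -/
theorem stmt_7 {K : Type*} [Field K] [CharZero K] (g₄ g₆ h₆ k₆ : K)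
    (hg₆ : g₆ ≠ 0) (hh₆ : h₆ ≠ 0) (hk₆ : k₆ ≠ 0)
    (hrel1 : g₆ ^ 2 + 2 * h₆ ^ 2 + k₆ ^ 2 = 0)
    (hrel2 : 4 * g₄ ^ 3 + 27 * h₆ ^ 2 + k₆ ^ 2 = 0)
    (j : K) (hj : j = g₄ ^ 3 / g₆ ^ 2) :
    Nonempty (ℍ[K, -10 * (1 - 4 * j), 5 * (8 * j - 27)] ≃ₐ[K] ℍ[K, -10, 5]) := by
  have hI : -10 * (1 - 4 * j) = -10 * (5 * h₆ / g₆) ^ 2 := by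
    rw [hj]
    field_simp
    linear_combination hrel2 - hrel1
  have hJ : 5 * (8 * j - 27) = 5 * (5 * k₆ / g₆) ^ 2 := by
    rw [hj]
    field_simp
    linear_combination 2 * hrel2 - 27 * hrel1
  have h5 : (5 : K) ≠ 0 := by norm_num
  rw [hI, hJ]
  exact ⟨quaternionAlgebraScaleEquiv _ _ (div_ne_zero (mul_ne_zero h5 hh₆) hg₆)
    (div_ne_zero (mul_ne_zero h5 hk₆) hg₆)⟩
end

section
/- Let A₆ = ℚ[h₄,h₆,h₁₂]/(h₁₂² + 3h₆⁴ + h₄⁶) and let σ be the ℚ-algebra involution of A₆ determined by σ(h₄) = −h₄, σ(h₆) = h₆, σ(h₁₂) = −h₁₂. Then the ℚ-algebra homomorphism ℚ[x,y,z] → A₆ given by x ↦ h₄², y ↦ h₆, z ↦ h₄h₁₂ sends z² + 3xy⁴ + x⁴ to 0 and induces a ℚ-algebra isomorphism ℚ[x,y,z]/(z² + 3xy⁴ + x⁴) ≅ A₆^σ, where A₆^σ is the subalgebra of σ-fixed elements of A₆. -/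
open MvPolynomial

/-- The canonical ring `A₆ = ℚ[h₄,h₆,h₁₂]/(h₁₂² + 3h₆⁴ + h₄⁶)` of the Shimura curve of
discriminant 6; the variables `X 0, X 1, X 2` play the roles of `h₄, h₆, h₁₂`. -/
noncomputable abbrev A6 : Type :=
  MvPolynomial (Fin 3) ℚ ⧸
    Ideal.span {(X 2 : MvPolynomial (Fin 3) ℚ) ^ 2 + 3 * X 1 ^ 4 + X 0 ^ 6}

/-- The class of `h₄` in `A₆`. -/
noncomputable def h4 : A6 := Ideal.Quotient.mk _ (X 0)

/-- The class of `h₆` in `A₆`. -/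
noncomputable def h6 : A6 := Ideal.Quotient.mk _ (X 1)

/-- The class of `h₁₂` in `A₆`. -/
noncomputable def h12 : A6 := Ideal.Quotient.mk _ (X 2)

theorem h12_sq : h12 ^ 2 = -(3 * h6 ^ 4 + h4 ^ 6) := by
  have h : (Ideal.Quotient.mk (Ideal.span
      {(X 2 : MvPolynomial (Fin 3) ℚ) ^ 2 + 3 * X 1 ^ 4 + X 0 ^ 6}))
      ((X 2 : MvPolynomial (Fin 3) ℚ) ^ 2 + 3 * X 1 ^ 4 + X 0 ^ 6) = 0 :=
    Ideal.Quotient.eq_zero_iff_mem.2 (Ideal.mem_span_singleton_self _)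
  simp only [map_add, map_mul, map_pow, map_ofNat] at h
  change h12 ^ 2 + 3 * h6 ^ 4 + h4 ^ 6 = 0 at h
  linear_combination h

/-- The homomorphism `ℚ[x,y,z] → A₆` with `x ↦ h₄²`, `y ↦ h₆`, `z ↦ h₄h₁₂`. -/
noncomputable def invariantHom : MvPolynomial (Fin 3) ℚ →ₐ[ℚ] A6 :=
  aeval ![h4 ^ 2, h6, h4 * h12]

@[simp] theorem invariantHom_X_zero : invariantHom (X 0) = h4 ^ 2 := by simp [invariantHom]

@[simp] theorem invariantHom_X_one : invariantHom (X 1) = h6 := by simp [invariantHom]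

@[simp] theorem invariantHom_X_two : invariantHom (X 2) = h4 * h12 := by simp [invariantHom]

theorem invariantHom_relation :
    invariantHom ((X 2 : MvPolynomial (Fin 3) ℚ) ^ 2 + 3 * X 0 * X 1 ^ 4 + X 0 ^ 4) = 0 := by
  simp only [map_add, map_mul, map_pow, map_ofNat, invariantHom_X_zero, invariantHom_X_one,
    invariantHom_X_two]
  linear_combination h4 ^ 2 * h12_sq

/-- `A₆` is spanned by `1, h₄, h₁₂` as a module over the image of `invariantHom`. -/
theorem exists_eq_invariantHom_add (a : A6) : ∃ s t u : MvPolynomial (Fin 3) ℚ,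
    a = invariantHom s + invariantHom t * h4 + invariantHom u * h12 := by
  obtain ⟨F, rfl⟩ := Ideal.Quotient.mk_surjective a
  induction F using MvPolynomial.induction_on with
  | C r =>
    refine ⟨C r, 0, 0, ?_⟩
    simp only [map_zero, zero_mul, add_zero]
    exact (invariantHom.commutes r).symm
  | add p q hp hq =>
    obtain ⟨s, t, u, h⟩ := hp
    obtain ⟨s', t', u', h'⟩ := hq
    refine ⟨s + s', t + t', u + u', ?_⟩
    simp only [map_add, h, h']
    ring
  | mul_X p i hp =>
    obtain ⟨s, t, u, h⟩ := hp
    rw [map_mul, h]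
    fin_cases i
    · refine ⟨t * X 0 + u * X 2, s, 0, ?_⟩
      change _ * h4 = _
      simp only [map_add, map_mul, map_zero, invariantHom_X_zero, invariantHom_X_two]
      ring
    · refine ⟨s * X 1, t * X 1, u * X 1, ?_⟩
      change _ * h6 = _
      simp only [map_mul, invariantHom_X_one]
      ring
    · refine ⟨t * X 2 - u * (3 * X 1 ^ 4 + X 0 ^ 3), 0, s, ?_⟩
      change _ * h12 = _
      simp only [map_add, map_sub, map_mul, map_pow, map_ofNat, map_zero, invariantHom_X_zero,
        invariantHom_X_one, invariantHom_X_two]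
      linear_combination invariantHom u * h12_sq

theorem apply_invariantHom (σ : A6 ≃ₐ[ℚ] A6) (hσ4 : σ h4 = -h4) (hσ6 : σ h6 = h6)
    (hσ12 : σ h12 = -h12) (q : MvPolynomial (Fin 3) ℚ) :
    σ (invariantHom q) = invariantHom q := by
  have h : (σ : A6 →ₐ[ℚ] A6).comp invariantHom = invariantHom := by
    ext i
    fin_cases i
    · simp only [Fin.zero_eta, AlgHom.comp_apply, invariantHom_X_zero, map_pow,
        AlgEquiv.coe_toAlgHom, hσ4]
      exact neg_sq h4
    · simpa using hσ6
    · simp only [Fin.reduceFinMk, AlgHom.comp_apply, invariantHom_X_two, map_mul,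
        AlgEquiv.coe_toAlgHom, hσ4, hσ12]
      exact neg_mul_neg h4 h12
  exact DFunLike.congr_fun h q

theorem exists_invariantHom_eq (σ : A6 ≃ₐ[ℚ] A6) (hσ4 : σ h4 = -h4) (hσ6 : σ h6 = h6)
    (hσ12 : σ h12 = -h12) {a : A6} (ha : σ a = a) : ∃ q, invariantHom q = a := by
  obtain ⟨s, t, u, rfl⟩ := exists_eq_invariantHom_add a
  refine ⟨s, ?_⟩
  simp only [map_add, map_mul, apply_invariantHom σ hσ4 hσ6 hσ12, hσ4, hσ12] at ha
  have h2 : (2 : ℚ) • (invariantHom t * h4 + invariantHom u * h12) = 0 := by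
    rw [ofNat_smul_eq_nsmul, two_nsmul]
    linear_combination -ha
  linear_combination -(smul_eq_zero_iff_right two_ne_zero).1 h2

/-- The inclusion `ℚ[y][x] → ℚ[x,y,z]`. -/
noncomputable def bivariateInclusion :
    Polynomial (Polynomial ℚ) →+* MvPolynomial (Fin 3) ℚ :=
  Polynomial.eval₂RingHom (Polynomial.aeval (X 1 : MvPolynomial (Fin 3) ℚ)).toRingHom (X 0)

@[simp] theorem bivariateInclusion_X : bivariateInclusion Polynomial.X = X 0 := by
  simp [bivariateInclusion]

@[simp] theorem bivariateInclusion_C_X :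
    bivariateInclusion (Polynomial.C Polynomial.X) = X 1 := by
  simp [bivariateInclusion]

@[simp] theorem bivariateInclusion_C_C (r : ℚ) :
    bivariateInclusion (Polynomial.C (Polynomial.C r)) = C r := by
  simp [bivariateInclusion, MvPolynomial.algebraMap_eq]

/-- Division with remainder by `z² + 3xy⁴ + x⁴`, viewed as a polynomial in `z`. -/
theorem exists_eq_bivariateInclusion_add (F : MvPolynomial (Fin 3) ℚ) :
    ∃ (p q : Polynomial (Polynomial ℚ)) (r : MvPolynomial (Fin 3) ℚ),
      F = bivariateInclusion p + bivariateInclusion q * X 2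
        + r * (X 2 ^ 2 + 3 * X 0 * X 1 ^ 4 + X 0 ^ 4) := by
  induction F using MvPolynomial.induction_on with
  | C c => exact ⟨Polynomial.C (Polynomial.C c), 0, 0, by simp⟩
  | add F G hF hG =>
    obtain ⟨p, q, r, h⟩ := hF
    obtain ⟨p', q', r', h'⟩ := hG
    refine ⟨p + p', q + q', r + r', ?_⟩
    simp only [map_add]
    linear_combination h + h'
  | mul_X F i hF =>
    obtain ⟨p, q, r, h⟩ := hF
    fin_cases i
    · refine ⟨p * Polynomial.X, q * Polynomial.X, r * X 0, ?_⟩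
      simp only [map_mul, bivariateInclusion_X, Fin.zero_eta]
      linear_combination X 0 * h
    · refine ⟨p * Polynomial.C Polynomial.X, q * Polynomial.C Polynomial.X, r * X 1, ?_⟩
      simp only [map_mul, bivariateInclusion_C_X, Fin.mk_one]
      linear_combination X 1 * h
    · refine ⟨-q * (3 * Polynomial.X * Polynomial.C Polynomial.X ^ 4 + Polynomial.X ^ 4), p,
        r * X 2 + bivariateInclusion q, ?_⟩
      simp only [map_mul, map_neg, map_add, map_pow, map_ofNat, bivariateInclusion_X,
        bivariateInclusion_C_X, Fin.reduceFinMk]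
      linear_combination X 2 * h

/-- The identification of `ℚ[h₄,h₆,h₁₂]` with iterated polynomials `ℚ[h₆][h₄][h₁₂]`. -/
noncomputable def toIterated :
    MvPolynomial (Fin 3) ℚ →ₐ[ℚ] Polynomial (Polynomial (Polynomial ℚ)) :=
  aeval (![Polynomial.C Polynomial.X, Polynomial.C (Polynomial.C Polynomial.X), Polynomial.X] :
    Fin 3 → Polynomial (Polynomial (Polynomial ℚ)))

/-- The substitution `x ↦ h₄²`, `y ↦ h₆`, `z ↦ h₄h₁₂` on polynomial rings. -/
noncomputable def substHom : MvPolynomial (Fin 3) ℚ →ₐ[ℚ] MvPolynomial (Fin 3) ℚ :=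
  aeval ![X 0 ^ 2, X 1, X 0 * X 2]

theorem mk_substHom (F : MvPolynomial (Fin 3) ℚ) :
    (Ideal.Quotient.mk _ (substHom F) : A6) = invariantHom F := by
  have h : (Ideal.Quotient.mkₐ ℚ (Ideal.span
      {(X 2 : MvPolynomial (Fin 3) ℚ) ^ 2 + 3 * X 1 ^ 4 + X 0 ^ 6})).comp substHom
        = invariantHom := by
    ext i
    fin_cases i <;> simp [substHom, h4, h6, h12]
  exact DFunLike.congr_fun h F

theorem toIterated_substHom_bivariateInclusion (p : Polynomial (Polynomial ℚ)) :
    toIterated (substHom (bivariateInclusion p)) =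
      Polynomial.C (Polynomial.expand (Polynomial ℚ) 2 p) := by
  have h : (toIterated.toRingHom.comp substHom.toRingHom).comp bivariateInclusion =
      Polynomial.C.comp (Polynomial.expand (Polynomial ℚ) 2).toRingHom := by
    ext <;> simp [toIterated, substHom, Polynomial.algebraMap_apply]
  exact DFunLike.congr_fun h p

theorem mem_span_of_invariantHom_eq_zero {F : MvPolynomial (Fin 3) ℚ}
    (hF : invariantHom F = 0) :
    F ∈ Ideal.span
      {(X 2 : MvPolynomial (Fin 3) ℚ) ^ 2 + 3 * X 0 * X 1 ^ 4 + X 0 ^ 4} := by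
  obtain ⟨p, q, r, rfl⟩ := exists_eq_bivariateInclusion_add F
  rw [map_add, map_mul _ r, invariantHom_relation, mul_zero, add_zero, ← mk_substHom,
    Ideal.Quotient.eq_zero_iff_mem, Ideal.mem_span_singleton] at hF
  have hdvd := map_dvd toIterated hF
  set c : Polynomial (Polynomial ℚ) := 3 * Polynomial.C Polynomial.X ^ 4 + Polynomial.X ^ 6
    with hc
  have hf : toIterated ((X 2 : MvPolynomial (Fin 3) ℚ) ^ 2 + 3 * X 1 ^ 4 + X 0 ^ 6) =
      Polynomial.X ^ 2 + Polynomial.C c := by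
    simp [toIterated, hc, add_assoc, map_ofNat Polynomial.C 3]
  have hg : toIterated (substHom (bivariateInclusion p + bivariateInclusion q * X 2)) =
      Polynomial.C (Polynomial.expand (Polynomial ℚ) 2 q * Polynomial.X) * Polynomial.X
        + Polynomial.C (Polynomial.expand (Polynomial ℚ) 2 p) := by
    have h2 : toIterated (substHom (X 2)) = Polynomial.C Polynomial.X * Polynomial.X := by
      simp [toIterated, substHom]
    simp only [map_add, map_mul, toIterated_substHom_bivariateInclusion, h2]
    ring
  rw [hf, hg] at hdvd
  have hmonic : (Polynomial.X ^ 2 + Polynomial.C c).Monic :=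
    Polynomial.monic_X_pow_add_C c two_ne_zero
  have hzero := Polynomial.eq_zero_of_dvd_of_degree_lt hdvd (by
    rw [Polynomial.degree_X_pow_add_C two_pos]
    exact Polynomial.degree_linear_lt)
  have hp : p = 0 := by
    have := congrArg (Polynomial.coeff · 0) hzero
    simpa [Polynomial.expand_eq_zero two_pos] using this
  have hq : q = 0 := by
    have := congrArg (Polynomial.coeff · 1) hzero
    simpa [Polynomial.coeff_C, Polynomial.expand_eq_zero two_pos] using this
  rw [hp, hq, map_zero, zero_mul, zero_add, zero_add]
  exact Ideal.mul_mem_left _ _ (Ideal.mem_span_singleton_self _)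

/-- if `σ` is the ℚ-algebra involution of `A₆` with `σ(h₄) = −h₄`,
`σ(h₆) = h₆`, `σ(h₁₂) = −h₁₂`, then the map `x ↦ h₄², y ↦ h₆, z ↦ h₄h₁₂` kills
`z² + 3xy⁴ + x⁴` and induces `ℚ[x,y,z]/(z² + 3xy⁴ + x⁴) ≅ A₆^σ`. -/
theorem stmt_10 (σ : A6 ≃ₐ[ℚ] A6)
    (hσ4 : σ h4 = -h4) (hσ6 : σ h6 = h6) (hσ12 : σ h12 = -h12) :
    aeval (![h4 ^ 2, h6, h4 * h12] : Fin 3 → A6)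
        ((X 2 : MvPolynomial (Fin 3) ℚ) ^ 2 + 3 * X 0 * X 1 ^ 4 + X 0 ^ 4) = 0 ∧
    ∃ ψ : (MvPolynomial (Fin 3) ℚ ⧸
            Ideal.span {(X 2 : MvPolynomial (Fin 3) ℚ) ^ 2 + 3 * X 0 * X 1 ^ 4 + X 0 ^ 4})
          ≃ₐ[ℚ] (AlgHom.equalizer (σ : A6 →ₐ[ℚ] A6) (AlgHom.id ℚ A6)),
      ∀ q : MvPolynomial (Fin 3) ℚ,
        (ψ (Ideal.Quotient.mk _ q) : A6) =
          aeval (![h4 ^ 2, h6, h4 * h12] : Fin 3 → A6) q := by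
  refine ⟨invariantHom_relation, ?_⟩
  let φ : MvPolynomial (Fin 3) ℚ →ₐ[ℚ]
      AlgHom.equalizer (σ : A6 →ₐ[ℚ] A6) (AlgHom.id ℚ A6) :=
    invariantHom.codRestrict _ (apply_invariantHom σ hσ4 hσ6 hσ12)
  have hker : Ideal.span
      {(X 2 : MvPolynomial (Fin 3) ℚ) ^ 2 + 3 * X 0 * X 1 ^ 4 + X 0 ^ 4} = RingHom.ker φ := by
    refine le_antisymm ?_ fun q hq => mem_span_of_invariantHom_eq_zero (congrArg Subtype.val hq)
    rw [Ideal.span_singleton_le_iff_mem]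
    exact Subtype.ext invariantHom_relation
  have hsurj : Function.Surjective φ := fun a => by
    obtain ⟨q, hq⟩ := exists_invariantHom_eq σ hσ4 hσ6 hσ12 a.2
    exact ⟨q, Subtype.ext hq⟩
  exact ⟨(Ideal.quotientEquivAlgOfEq ℚ hker).trans
    (Ideal.quotientKerAlgEquivOfSurjective hsurj), fun q => rfl⟩
end

section
/- Let K be a number field with a fixed algebraic closure K̄. For B > 0 let N(B) denote the number of intermediate fields K ⊆ L ⊆ K̄ such that L/K is a Galois extension of degree 8 with Galois group isomorphic to the dihedral group D₄ of order 8 and such that the absolute norm |N_{K/ℚ}(𝔡_{L/K})| of the relative discriminant ideal 𝔡_{L/K} is at most B. Then N(B) = O(B^{1/2}), i.e. there is a constant C > 0 such that N(B) ≤ C·B^{1/2} for all B ≥ 2. -/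
open NumberField

/-- A finite extension of a number field is a number field. -/
theorem numberField_of_finiteDimensional (K : Type*) [Field K] [NumberField K]
    (L : Type*) [Field L] [Algebra K L] [FiniteDimensional K L] : NumberField L := by
  haveI : CharZero L := charZero_of_injective_algebraMap (algebraMap K L).injective
  haveI : FiniteDimensional ℚ L := Module.Finite.trans K L
  exact ⟨⟩

/-- The absolute norm `|N_{K/ℚ}(𝔡_{L/K})|` of the relative discriminant ideal
`𝔡_{L/K} = N_{L/K}(𝔇_{L/K})` of an extension `L/K` of number fields, where the relative
norm of the different ideal `𝔇_{L/K}` is the ideal of `𝓞 K` generated by the norms of its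
elements. -/
noncomputable def relDiscAbsNorm (K L : Type*) [Field K] [NumberField K] [Field L]
    [NumberField L] [Algebra K L] : ℕ :=
  Ideal.absNorm (Ideal.span
    (Algebra.intNorm (𝓞 K) (𝓞 L) '' (differentIdeal (𝓞 K) (𝓞 L) : Set (𝓞 L))))

section Selmer

open IsDedekindDomain IsDedekindDomain.HeightOneSpectrum nonZeroDivisors

variable {R : Type*} [CommRing R] [IsDedekindDomain R] {K : Type*} [Field K] [Algebra R K]
  [IsFractionRing R K]

theorem valuationOfNeZeroMod_two_eq_one_iff (v : HeightOneSpectrum R) (a : Kˣ) :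
    v.valuationOfNeZeroMod 2 (QuotientGroup.mk a) = 1 ↔
      ∃ k : Multiplicative ℤ, v.valuationOfNeZero a = k ^ 2 := by
  have h1 : v.valuationOfNeZeroMod 2 (QuotientGroup.mk a) = 1 ↔
      v.valuationOfNeZero a ∈ AddSubgroup.toSubgroup (AddSubgroup.zmultiples (2 : ℤ)) := by
    rw [← QuotientGroup.eq_one_iff]
    exact MulEquiv.map_eq_one_iff
      (AddEquiv.toMultiplicative (Int.quotientZMultiplesNatEquivZMod 2))
  rw [h1]
  change (v.valuationOfNeZero a).toAdd ∈ AddSubgroup.zmultiples (2 : ℤ) ↔ _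
  rw [AddSubgroup.mem_zmultiples_iff]
  constructor
  · rintro ⟨k, hk⟩
    refine ⟨Multiplicative.ofAdd k, Multiplicative.toAdd.injective ?_⟩
    rw [toAdd_pow, toAdd_ofAdd, ← hk]
    simp [mul_comm]
  · rintro ⟨k, hk⟩
    refine ⟨k.toAdd, ?_⟩
    rw [hk, toAdd_pow]
    simp [mul_comm]

theorem count_spanSingleton_eq (v : HeightOneSpectrum R) (a : Kˣ) :
    FractionalIdeal.count K v (FractionalIdeal.spanSingleton R⁰ (a : K)) =
      -(v.valuationOfNeZero a).toAdd := by
  classical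
  set s := IsLocalization.sec R⁰ (a : K) with hs
  have h0 : FractionalIdeal.spanSingleton R⁰ (a : K) ≠ 0 := by
    rw [Ne, FractionalIdeal.spanSingleton_eq_zero_iff]
    exact a.ne_zero
  have hsec := IsLocalization.sec_spec R⁰ (a : K)
  have h2 : algebraMap R K s.2 ≠ 0 := by
    simp
  rw [FractionalIdeal.count_well_defined K v h0 (a := s.2) (J := Ideal.span {s.1})]
  · change _ = - (-_ - -_ : ℤ)
    rw [← hs]
    ring
  · rw [FractionalIdeal.coeIdeal_span_singleton, FractionalIdeal.spanSingleton_mul_spanSingleton]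
    congr 1
    rw [hs, ← hsec]
    field_simp

theorem exists_sq_eq_toPrincipalIdeal (a : Kˣ)
    (h : ∀ v : HeightOneSpectrum R, ∃ k : Multiplicative ℤ, v.valuationOfNeZero a = k ^ 2) :
    ∃ J : (FractionalIdeal R⁰ K)ˣ, toPrincipalIdeal R K a = J ^ 2 := by
  choose k hk using h
  have h0 : FractionalIdeal.spanSingleton R⁰ (a : K) ≠ 0 := by
    rw [Ne, FractionalIdeal.spanSingleton_eq_zero_iff]
    exact a.ne_zero
  have hc (v : HeightOneSpectrum R) :
      FractionalIdeal.count K v (FractionalIdeal.spanSingleton R⁰ (a : K)) =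
        -(k v).toAdd * (2 : ℕ) := by
    rw [count_spanSingleton_eq, hk, toAdd_pow]; simp [mul_comm]
  set J : FractionalIdeal R⁰ K :=
    ∏ᶠ v : HeightOneSpectrum R, (v.asIdeal : FractionalIdeal R⁰ K) ^ (-(k v).toAdd) with hJ
  have hfin : (Function.mulSupport fun v : HeightOneSpectrum R ↦
      (v.asIdeal : FractionalIdeal R⁰ K) ^ (-(k v).toAdd)).Finite := by
    refine (Filter.eventually_cofinite.mp (FractionalIdeal.finite_factors
      (FractionalIdeal.spanSingleton R⁰ (a : K)))).subset fun v hv h ↦ hv ?_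
    have : (k v).toAdd = 0 := by
      have := (hc v).symm.trans h
      push_cast at this
      omega
    simp [this]
  have hsq : FractionalIdeal.spanSingleton R⁰ (a : K) = J ^ 2 := by
    rw [hJ, finprod_pow hfin,
      ← FractionalIdeal.finprod_heightOneSpectrum_factorization' K h0]
    refine finprod_congr fun v ↦ ?_
    rw [hc, zpow_mul, zpow_natCast]
  have hJ0 : J ≠ 0 := by
    intro h
    rw [h] at hsq
    exact h0 (by simpa using hsq)
  refine ⟨Units.mk0 J hJ0, Units.ext ?_⟩
  simpa using hsq

theorem exists_unit_of_toPrincipalIdeal_eq_one (a : Kˣ) (h : toPrincipalIdeal R K a = 1) :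
    ∃ u : Rˣ, Units.map (algebraMap R K : R →* K) u = a := by
  have h1 : FractionalIdeal.spanSingleton R⁰ (a : K) = 1 := by
    simpa using congrArg Units.val h
  have h2 : toPrincipalIdeal R K a⁻¹ = 1 := by rw [map_inv, h, inv_one]
  have h3 : FractionalIdeal.spanSingleton R⁰ ((a⁻¹ : Kˣ) : K) = 1 := by
    simpa using congrArg Units.val h2
  obtain ⟨x, hx⟩ := (FractionalIdeal.mem_one_iff R⁰).mp
    (h1 ▸ FractionalIdeal.mem_spanSingleton_self R⁰ (a : K))
  obtain ⟨y, hy⟩ := (FractionalIdeal.mem_one_iff R⁰).mp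
    (h3 ▸ FractionalIdeal.mem_spanSingleton_self R⁰ ((a⁻¹ : Kˣ) : K))
  have hxy : x * y = 1 := by
    apply FaithfulSMul.algebraMap_injective R K
    rw [map_mul, hx, hy, map_one, Units.mul_inv]
  exact ⟨⟨x, y, hxy, by rw [mul_comm, hxy]⟩, Units.ext hx⟩

variable (R K) in
theorem finite_selmerGroup_empty [Finite (ClassGroup R)] [Monoid.FG Rˣ] :
    Finite (selmerGroup (R := R) (K := K) (S := ∅) (n := 2)) := by
  have : Group.FG Rˣ := Group.fg_iff_monoid_fg.mpr inferInstance
  have : Finite (Rˣ ⧸ (powMonoidHom 2 : Rˣ →* Rˣ).range) :=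
    Subgroup.finiteIndex_iff_finite_quotient.mp
      (Subgroup.finiteIndex_range_powMonoidHom_of_fg Rˣ two_ne_zero)
  have : Finite ((FractionalIdeal R⁰ K)ˣ ⧸ (toPrincipalIdeal R K).range) :=
    Finite.of_equiv _ (ClassGroup.equiv (R := R) K).toEquiv
  have key (q : selmerGroup (R := R) (K := K) (S := ∅) (n := 2)) :
      ∃ (a : Kˣ) (J : (FractionalIdeal R⁰ K)ˣ), QuotientGroup.mk a = q.1 ∧
        toPrincipalIdeal R K a = J ^ 2 := by
    obtain ⟨⟨a⟩, hq⟩ := q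
    obtain ⟨J, hJ⟩ := exists_sq_eq_toPrincipalIdeal (R := R) a fun v ↦
      (valuationOfNeZeroMod_two_eq_one_iff v a).mp (hq v (by simp))
    exact ⟨a, J, rfl, hJ⟩
  choose a J ha hJ using key
  rw [← Set.finite_univ_iff]
  refine Set.Finite.of_finite_fibers
    (fun q ↦ (QuotientGroup.mk (J q) : (FractionalIdeal R⁰ K)ˣ ⧸ (toPrincipalIdeal R K).range))
    (Set.toFinite _) ?_
  rintro _ ⟨q₀, -, rfl⟩
  rw [Set.univ_inter]
  have hu : Finite (selmerGroup.fromUnit (R := R) (K := K) (n := 2)).range := by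
    have : Fact (0 < 2) := ⟨by norm_num⟩
    exact Finite.of_equiv _ ((QuotientGroup.quotientMulEquivOfEq
      selmerGroup.fromUnit_ker.symm).trans (QuotientGroup.quotientKerEquivRange
        (selmerGroup.fromUnit (R := R) (K := K) (n := 2)))).toEquiv
  refine ((Set.toFinite ((selmerGroup.fromUnit (R := R) (K := K) (n := 2)).range : Set _)).image
    (q₀ * ·)).subset ?_
  intro q hq
  rw [Set.mem_preimage, Set.mem_singleton_iff, eq_comm, QuotientGroup.eq] at hq
  obtain ⟨c, hc⟩ := hq
  obtain ⟨u, hu⟩ := exists_unit_of_toPrincipalIdeal_eq_one (R := R) ((a q₀)⁻¹ * a q * (c⁻¹) ^ 2) (by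
    rw [map_mul, map_mul, map_pow, map_inv, map_inv, hc, hJ, hJ, mul_inv, inv_inv, mul_pow, inv_pow]
    rw [mul_comm (J q₀ ^ 2), mul_mul_mul_comm]
    simp)
  refine ⟨_, ⟨u, rfl⟩, Subtype.ext ?_⟩
  change q₀.1 * QuotientGroup.mk (Units.map (algebraMap R K : R →* K) u) = q.1
  rw [hu, ← ha q₀, ← ha q, ← QuotientGroup.mk_mul, QuotientGroup.eq]
  refine ⟨c, ?_⟩
  rw [powMonoidHom_apply, inv_pow]
  group

variable (K) in
theorem card_selmerGroup_le [Finite (ClassGroup R)] [Monoid.FG Rˣ]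
    (S : Finset (HeightOneSpectrum R)) :
    Finite (selmerGroup (R := R) (K := K) (S := (S : Set (HeightOneSpectrum R))) (n := 2)) ∧
    Nat.card (selmerGroup (R := R) (K := K) (S := (S : Set (HeightOneSpectrum R))) (n := 2)) ≤
      Nat.card (selmerGroup (R := R) (K := K) (S := ∅) (n := 2)) * 2 ^ S.card := by
  have hfin := finite_selmerGroup_empty R K
  set f := selmerGroup.valuation (R := R) (K := K) (S := (S : Set (HeightOneSpectrum R))) (n := 2)
  have hker : f.ker = _ := selmerGroup.valuation_ker_eq
  have hcard : Nat.card f.ker ≤ Nat.card (selmerGroup (R := R) (K := K) (S := ∅) (n := 2)) := by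
    rw [hker]
    exact Nat.card_le_card_of_injective
      (fun x ↦ (⟨x.1.1, x.2⟩ : selmerGroup (R := R) (K := K) (S := ∅) (n := 2)))
      fun x y h ↦ Subtype.ext (Subtype.ext (Subtype.mk.inj h))
  have hkerfin : Finite f.ker := by
    rw [hker]
    exact Finite.of_injective
      (fun x ↦ (⟨x.1.1, x.2⟩ : selmerGroup (R := R) (K := K) (S := ∅) (n := 2)))
      fun x y h ↦ Subtype.ext (Subtype.ext (Subtype.mk.inj h))
  have : Finite (Multiplicative (ZMod 2)) := inferInstanceAs (Finite (ZMod 2))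
  have hrange : Nat.card f.range ≤ 2 ^ S.card := by
    refine (Nat.card_le_card_of_injective _ Subtype.val_injective).trans ?_
    rw [Nat.card_fun]
    simp
  have hquot : Finite (_ ⧸ f.ker) :=
    Finite.of_equiv _ (QuotientGroup.quotientKerEquivRange f).toEquiv.symm
  have hfinG : Finite
      (selmerGroup (R := R) (K := K) (S := (S : Set (HeightOneSpectrum R))) (n := 2)) :=
    Finite.of_equiv _ (Subgroup.groupEquivQuotientProdSubgroup (s := f.ker)).symm
  refine ⟨hfinG, ?_⟩
  rw [Subgroup.card_eq_card_quotient_mul_card_subgroup f.ker,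
    Nat.card_congr (QuotientGroup.quotientKerEquivRange f).toEquiv, mul_comm]
  gcongr

end Selmer

section Counting

open IsDedekindDomain

variable (K : Type*) [Field K] [NumberField K]

theorem summable_card_absNorm_eq_div_sq :
    Summable fun n : ℕ ↦ (Nat.card {I : Ideal (𝓞 K) // Ideal.absNorm I = n} : ℝ) / (n : ℝ) ^ 2 := by
  have hsum : LSeriesSummable
      (fun n : ℕ ↦ ((Nat.card {I : Ideal (𝓞 K) // Ideal.absNorm I = n} : ℝ) : ℂ)) 2 := by
    refine LSeriesSummable_of_sum_norm_bigO_and_nonneg (r := 1) ?_ (fun _ ↦ Nat.cast_nonneg _)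
      zero_le_one (by norm_num)
    have hlim := (Ideal.tendsto_norm_le_div_atTop₀ K).comp tendsto_natCast_atTop_atTop
    have hO := hlim.isBigO_one ℝ
    have := hO.mul (Asymptotics.isBigO_refl (fun n : ℕ ↦ (n : ℝ)) Filter.atTop)
    simp only [one_mul] at this
    simp only [Real.rpow_one]
    refine this.congr' ?_ Filter.EventuallyEq.rfl
    filter_upwards [Filter.eventually_gt_atTop 0] with n hn
    have hn' : (n : ℝ) ≠ 0 := by positivity
    simp only [Function.comp_apply, Nat.cast_le, ← Nat.cast_sum]
    rw [div_mul_cancel₀ _ hn', Nat.cast_inj, ← add_left_inj 1,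
      ← Ideal.card_norm_le_eq_card_norm_le_add_one,
      show Finset.Icc 1 n = Finset.Ioc 0 n from Finset.Icc_succ_left_eq_Ioc _ _,
      show 1 = Nat.card {I : Ideal (𝓞 K) // Ideal.absNorm I = 0} by
        simp [Ideal.absNorm_eq_zero_iff],
      Finset.sum_Ioc_add_eq_sum_Icc n.zero_le,
      ← Finset.card_preimage_eq_sum_card_image_eq
        (fun k _ ↦ Ideal.finite_setOfPred_absNorm_eq k)]
    simp [Set.coe_eq_subtype]
  have := hsum.norm
  refine this.congr fun n ↦ ?_
  rcases eq_or_ne n 0 with rfl | hn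
  · simp
  · rw [LSeries.term_of_ne_zero hn]
    simp

theorem exists_sum_inv_absNorm_sq_le :
    ∃ M : ℝ, ∀ F : Finset (HeightOneSpectrum (𝓞 K)),
      ∑ p ∈ F, ((Ideal.absNorm p.asIdeal : ℝ) ^ 2)⁻¹ ≤ M := by
  classical
  refine ⟨_, fun F ↦ le_trans ?_ ((summable_card_absNorm_eq_div_sq K).sum_le_tsum
    (F.image fun p ↦ Ideal.absNorm p.asIdeal) fun _ _ ↦ by positivity)⟩
  rw [← Finset.sum_fiberwise_of_maps_to
    (fun p hp ↦ Finset.mem_image_of_mem (fun p ↦ Ideal.absNorm p.asIdeal) hp)]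
  refine Finset.sum_le_sum fun n _ ↦ ?_
  rw [Finset.sum_congr rfl (g := fun _ ↦ ((n : ℝ) ^ 2)⁻¹)
    (fun p hp ↦ by rw [(Finset.mem_filter.mp hp).2]), Finset.sum_const, nsmul_eq_mul,
    div_eq_mul_inv]
  gcongr
  have : Finite {I : Ideal (𝓞 K) // Ideal.absNorm I = n} :=
    Ideal.finite_setOfPred_absNorm_eq n
  rw [← Nat.card_eq_finsetCard]
  exact Nat.card_le_card_of_injective (fun p ↦ ⟨p.1.asIdeal, (Finset.mem_filter.mp p.2).2⟩)
    fun p q h ↦ Subtype.ext (HeightOneSpectrum.ext (Subtype.mk.inj h))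

theorem exists_sum_pow_card_le (A : ℝ) (hA : 0 ≤ A) :
    ∃ M : ℝ, 0 < M ∧ ∀ X : ℝ, 0 ≤ X → ∀ T : Finset (Finset (HeightOneSpectrum (𝓞 K))),
      (∀ S ∈ T, ((∏ p ∈ S, Ideal.absNorm p.asIdeal : ℕ) : ℝ) ≤ X) →
      ∑ S ∈ T, A ^ S.card ≤ M * X ^ 2 := by
  classical
  obtain ⟨M, hM⟩ := exists_sum_inv_absNorm_sq_le K
  have hpos (p : HeightOneSpectrum (𝓞 K)) : (0 : ℝ) < Ideal.absNorm p.asIdeal :=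
    Nat.cast_pos.mpr (Nat.pos_of_ne_zero (Ideal.absNorm_eq_zero_iff.not.mpr p.ne_bot))
  refine ⟨Real.exp (A * M), Real.exp_pos _, fun X hX T hT ↦ ?_⟩
  set g : HeightOneSpectrum (𝓞 K) → ℝ := fun p ↦ A * ((Ideal.absNorm p.asIdeal : ℝ) ^ 2)⁻¹
  have hg (p) : 0 ≤ g p := by positivity
  calc ∑ S ∈ T, A ^ S.card ≤ ∑ S ∈ T, (∏ p ∈ S, g p) * X ^ 2 := by
        refine Finset.sum_le_sum fun S hS ↦ ?_
        have h := hT S hS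
        rw [Nat.cast_prod] at h
        have hp : 0 < ∏ p ∈ S, (Ideal.absNorm p.asIdeal : ℝ) := Finset.prod_pos fun p _ ↦ hpos p
        simp only [g, Finset.prod_mul_distrib, Finset.prod_const, Finset.prod_inv_distrib,
          Finset.prod_pow]
        rw [mul_assoc]
        refine le_mul_of_one_le_right (by positivity) ?_
        rw [inv_mul_eq_div, one_le_div (by positivity)]
        gcongr
    _ = (∑ S ∈ T, ∏ p ∈ S, g p) * X ^ 2 := by rw [Finset.sum_mul]
    _ ≤ Real.exp (A * M) * X ^ 2 := by
        gcongr
        calc ∑ S ∈ T, ∏ p ∈ S, g p ≤ ∑ S ∈ (T.biUnion id).powerset, ∏ p ∈ S, g p := by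
              refine Finset.sum_le_sum_of_subset_of_nonneg (fun S hS ↦ ?_)
                fun S _ _ ↦ Finset.prod_nonneg fun p _ ↦ hg p
              exact Finset.mem_powerset.mpr (Finset.subset_biUnion_of_mem id hS)
          _ = ∏ p ∈ T.biUnion id, (1 + g p) := (Finset.prod_one_add _).symm
          _ ≤ ∏ p ∈ T.biUnion id, Real.exp (g p) :=
              Finset.prod_le_prod (fun p _ ↦ by have := hg p; positivity)
                fun p _ ↦ by rw [add_comm]; exact Real.add_one_le_exp _
          _ = Real.exp (∑ p ∈ T.biUnion id, g p) := (Real.exp_sum _ _).symm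
          _ ≤ Real.exp (A * M) := by
              rw [Real.exp_le_exp, ← Finset.mul_sum]
              exact mul_le_mul_of_nonneg_left (hM _) hA

end Counting

section Ramification

open IsDedekindDomain

variable (K L : Type*) [Field K] [NumberField K] [Field L] [NumberField L] [Algebra K L]

/-- The primes `p` of `K` such that `p 𝓞_L` divides the square of the different. For a Galois
extension these include all ramified primes. -/
def ramSet : Set (HeightOneSpectrum (𝓞 K)) :=
  {p | p.asIdeal.map (algebraMap (𝓞 K) (𝓞 L)) ∣ differentIdeal (𝓞 K) (𝓞 L) ^ 2}

theorem prod_map_dvd_differentIdeal_sq (S : Finset (HeightOneSpectrum (𝓞 K)))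
    (hS : ↑S ⊆ ramSet K L) :
    (∏ p ∈ S, p.asIdeal).map (algebraMap (𝓞 K) (𝓞 L)) ∣ differentIdeal (𝓞 K) (𝓞 L) ^ 2 := by
  have : (∏ p ∈ S, p.asIdeal).map (algebraMap (𝓞 K) (𝓞 L)) =
      ∏ p ∈ S, p.asIdeal.map (algebraMap (𝓞 K) (𝓞 L)) :=
    map_prod (Ideal.mapHom (algebraMap (𝓞 K) (𝓞 L))) _ _
  rw [this]
  refine Finset.prod_dvd_of_coprime (fun p _ q _ hpq => ?_) fun p hp => hS hp
  exact (HeightOneSpectrum.isCoprime_of_ne p q hpq).map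
    (Ideal.mapHom (algebraMap (𝓞 K) (𝓞 L)))

theorem relDiscAbsNorm_eq :
    relDiscAbsNorm K L = Ideal.absNorm (differentIdeal (𝓞 K) (𝓞 L)) := by
  rw [← Ideal.absNorm_relNorm (𝓞 K) (𝓞 L), Ideal.relNorm_apply]
  rfl

theorem prod_absNorm_pow_dvd (S : Finset (HeightOneSpectrum (𝓞 K)))
    (hS : ↑S ⊆ ramSet K L) :
    (∏ p ∈ S, Ideal.absNorm p.asIdeal) ^ Module.finrank K L ∣ relDiscAbsNorm K L ^ 2 := by
  have := Ideal.absNorm_dvd_absNorm_of_le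
    (Ideal.le_of_dvd (prod_map_dvd_differentIdeal_sq K L S hS))
  rwa [Ideal.absNorm_algebraMap, map_pow, ← relDiscAbsNorm_eq, map_prod,
    ← IsFractionRing.finrank_eq (𝓞 K) K (𝓞 L) L] at this

theorem relDiscAbsNorm_ne_zero : relDiscAbsNorm K L ≠ 0 := by
  rw [relDiscAbsNorm_eq, Ne, Ideal.absNorm_eq_zero_iff]
  exact differentIdeal_ne_bot

variable {K L} in
theorem prod_absNorm_pow_four_le (hKL : Module.finrank K L = 8)
    (S : Finset (HeightOneSpectrum (𝓞 K))) (hS : ↑S ⊆ ramSet K L) :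
    (∏ p ∈ S, Ideal.absNorm p.asIdeal) ^ 4 ≤ relDiscAbsNorm K L := by
  have h := prod_absNorm_pow_dvd K L S hS
  rw [hKL, show 8 = 4 * 2 from rfl, pow_mul] at h
  exact Nat.le_of_dvd (Nat.pos_of_ne_zero (relDiscAbsNorm_ne_zero K L))
    ((Nat.pow_dvd_pow_iff two_ne_zero).1 h)

theorem finite_ramSet : (ramSet K L).Finite := by
  have hD : differentIdeal (𝓞 K) (𝓞 L) ≠ ⊥ := differentIdeal_ne_bot
  refine Set.Finite.of_injOn (f := fun p : HeightOneSpectrum (𝓞 K) =>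
    p.asIdeal.map (algebraMap (𝓞 K) (𝓞 L)))
    (t := {I | I ∣ differentIdeal (𝓞 K) (𝓞 L) ^ 2}) (fun p hp => hp) ?_ ?_
  · intro p _ q _ h
    by_contra hpq
    have h1 := (HeightOneSpectrum.isCoprime_of_ne p q hpq).map
      (Ideal.mapHom (algebraMap (𝓞 K) (𝓞 L)))
    simp only at h
    rw [Ideal.mapHom_apply, Ideal.mapHom_apply, h, isCoprime_self, Ideal.isUnit_iff] at h1
    obtain ⟨Q, hQ, hQ'⟩ := Ideal.exists_maximal_ideal_liesOver_of_isIntegral (S := 𝓞 L) q.asIdeal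
    have : q.asIdeal.map (algebraMap (𝓞 K) (𝓞 L)) ≤ Q := Ideal.map_le_iff_le_comap.2 hQ'.over.le
    exact hQ.ne_top (top_le_iff.1 (h1 ▸ this))
  · have : (differentIdeal (𝓞 K) (𝓞 L) ^ 2) ≠ 0 := pow_ne_zero 2 hD
    exact Set.finite_coe_iff.1 (UniqueFactorizationMonoid.fintypeSubtypeDvd _ this).finite

variable {K L} in
theorem ramificationIdx'_eq_one_of_notMem_ramSet [IsGalois K L] {p : HeightOneSpectrum (𝓞 K)}
    (hp : p ∉ ramSet K L) (q : HeightOneSpectrum (𝓞 L)) [q.asIdeal.LiesOver p.asIdeal] :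
    p.asIdeal.ramificationIdx' q.asIdeal = 1 := by
  have hq0 := Ideal.IsDedekindDomain.ramificationIdx'_ne_zero_of_liesOver q.asIdeal p.ne_bot
  rw [Ideal.ramificationIdx'_eq_ramificationIdx _ _ p.ne_bot] at hq0 ⊢
  by_contra hne
  refine hp ?_
  have hmap := Ideal.map_algebraMap_eq_finsetProd_pow (R := 𝓞 L) p.ne_bot
  change p.asIdeal.map (algebraMap (𝓞 K) (𝓞 L)) ∣ differentIdeal (𝓞 K) (𝓞 L) ^ 2
  rw [hmap]
  refine Finset.prod_dvd_of_coprime (fun P hP Q hQ hPQ => ?_) fun P hP => ?_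
  · obtain ⟨hP1, hP2⟩ := Set.mem_toFinset.1 hP
    obtain ⟨hQ1, hQ2⟩ := Set.mem_toFinset.1 hQ
    have := Ideal.IsMaximal.of_liesOver_isMaximal P p.asIdeal
    have := Ideal.IsMaximal.of_liesOver_isMaximal Q p.asIdeal
    exact (Ideal.isCoprime_of_isMaximal hPQ).pow
  · obtain ⟨hP1, hP2⟩ := Set.mem_toFinset.1 hP
    have he : P.ramificationIdx (𝓞 K) = q.asIdeal.ramificationIdx (𝓞 K) :=
      Ideal.ramificationIdx_eq_of_isGaloisGroup p.asIdeal P q.asIdeal Gal(L/K)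
    have hd := pow_sub_one_dvd_differentIdeal (𝓞 K) P (P.ramificationIdx (𝓞 K)) p.ne_bot
      (hmap ▸ Finset.dvd_prod_of_mem _ hP)
    refine dvd_trans (pow_dvd_pow P ?_) ((pow_mul P _ 2) ▸ pow_dvd_pow_of_dvd hd 2)
    lia

variable {K L} in
theorem exists_valuation_eq_of_notMem_ramSet (N : Type*) [Field N] [NumberField N] [Algebra L N]
    [Algebra K N] [IsScalarTower K L N] [IsGalois K L] {p : HeightOneSpectrum (𝓞 K)}
    (hp : p ∉ ramSet K L) (w : HeightOneSpectrum (𝓞 N)) [w.asIdeal.LiesOver p.asIdeal]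
    {x : L} (hx : x ≠ 0) :
    ∃ c : K, c ≠ 0 ∧ w.valuation N (algebraMap L N x) = w.valuation N (algebraMap K N c) := by
  have hqp : (w.asIdeal.under (𝓞 L)).LiesOver p.asIdeal :=
    Ideal.LiesOver.tower_bot w.asIdeal _ p.asIdeal
  let q : HeightOneSpectrum (𝓞 L) := ⟨w.asIdeal.under (𝓞 L), inferInstance,
    Ideal.ne_bot_of_liesOver_of_ne_bot p.ne_bot _⟩
  have : q.asIdeal.LiesOver p.asIdeal := hqp
  have : w.asIdeal.LiesOver q.asIdeal := ⟨rfl⟩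
  obtain ⟨π, hπ⟩ := p.valuation_exists_uniformizer K
  have hπ0 : π ≠ 0 := by
    rintro rfl
    exact WithZero.exp_ne_zero ((map_zero (p.valuation K)).symm.trans hπ).symm
  have he := ramificationIdx'_eq_one_of_notMem_ramSet hp q
  obtain ⟨n, hn⟩ : ∃ n : ℤ, q.valuation L x = WithZero.exp n :=
    ⟨_, (WithZero.exp_log ((Valuation.ne_zero_iff _).2 hx)).symm⟩
  refine ⟨π ^ (-n), zpow_ne_zero _ hπ0, ?_⟩
  rw [← HeightOneSpectrum.valuation_liesOver N q w, IsScalarTower.algebraMap_apply K L N,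
    ← HeightOneSpectrum.valuation_liesOver N q w, ← HeightOneSpectrum.valuation_liesOver L p q,
    he, pow_one, map_zpow₀, hπ, hn, ← WithZero.exp_zsmul]
  simp

theorem exists_valuation_eq_sq {K L L₀ N : Type*} [Field K] [NumberField K] [Field L]
    [NumberField L] [Field L₀] [NumberField L₀] [Field N] [NumberField N] [Algebra K L]
    [Algebra K L₀] [Algebra K N] [Algebra L N] [Algebra L₀ N] [IsScalarTower K L N]
    [IsScalarTower K L₀ N] [IsGalois K L] [IsGalois K L₀] {p : HeightOneSpectrum (𝓞 K)}
    (hp : p ∉ ramSet K L) (hp₀ : p ∉ ramSet K L₀) {t : K} {s : N} {x : L} {x₀ : L₀}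
    (ht : s ^ 2 = algebraMap K N t) (hs : algebraMap L₀ N x₀ * s = algebraMap L N x)
    (hx : x ≠ 0) (hx₀ : x₀ ≠ 0) :
    ∃ c : K, c ≠ 0 ∧ p.valuation K t = p.valuation K c ^ 2 := by
  obtain ⟨Q, hQ, hQp⟩ := Ideal.exists_maximal_ideal_liesOver_of_isIntegral (S := 𝓞 N) p.asIdeal
  let w : HeightOneSpectrum (𝓞 N) := ⟨Q, inferInstance,
    Ideal.ne_bot_of_liesOver_of_ne_bot p.ne_bot _⟩
  have : w.asIdeal.LiesOver p.asIdeal := hQp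
  obtain ⟨c, hc, hxc⟩ := exists_valuation_eq_of_notMem_ramSet N hp w hx
  obtain ⟨c₀, hc₀, hxc₀⟩ := exists_valuation_eq_of_notMem_ramSet N hp₀ w hx₀
  refine ⟨c / c₀, div_ne_zero hc hc₀, ?_⟩
  have hw : w.valuation N s = w.valuation N (algebraMap K N (c / c₀)) := by
    have := congrArg (w.valuation N) hs
    rw [map_mul, hxc, hxc₀] at this
    rw [map_div₀, map_div₀, ← this, mul_div_cancel_left₀]
    simpa [Valuation.ne_zero_iff] using hc₀
  have he := Ideal.IsDedekindDomain.ramificationIdx'_ne_zero_of_liesOver w.asIdeal p.ne_bot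
  rw [← pow_left_inj₀ zero_le zero_le he, pow_right_comm,
    HeightOneSpectrum.valuation_liesOver N p w, HeightOneSpectrum.valuation_liesOver N p w,
    ← ht, map_pow, hw]

end Ramification

section Kummer

open IntermediateField

variable {K Ω : Type*} [Field K] [Field Ω] [Algebra K Ω]

/-- The quadratic character `ψ` is cut out by a square root of `t`. -/
def IsKummerChar (ψ : Gal(Ω/K) →* ℤˣ) (t : Kˣ) : Prop :=
  ∃ s : Ω, s ^ 2 = algebraMap K Ω t ∧ ∀ g, g s = ((ψ g : ℤ) : Ω) * s

theorem exists_kummer_generator [IsGalois K Ω] [CharZero Ω] (ψ : Gal(Ω/K) →* ℤˣ)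
    (N : IntermediateField K Ω) [FiniteDimensional K N] (hN : N.fixingSubgroup ≤ ψ.ker) :
    ∃ (t : Kˣ) (s : N), (s : Ω) ^ 2 = algebraMap K Ω t ∧
      ∀ g : Gal(Ω/K), g s = ((ψ g : ℤ) : Ω) * s := by
  obtain ⟨s, hs0, hs⟩ : ∃ s : Ω, s ≠ 0 ∧ ∀ g : Gal(Ω/K), g s = ((ψ g : ℤ) : Ω) * s := by
    by_cases hψ : ∀ g, ψ g = 1
    · exact ⟨1, one_ne_zero, fun g => by simp [hψ]⟩
    push Not at hψ
    obtain ⟨g₀, hg₀⟩ := hψ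
    have hclosed : IsClosed (ψ.ker : Set Gal(Ω/K)) :=
      Subgroup.isClosed_of_isOpen _ (Subgroup.isOpen_mono hN N.fixingSubgroup_isOpen)
    have hfix : (fixedField ψ.ker).fixingSubgroup = ψ.ker :=
      InfiniteGalois.fixingSubgroup_fixedField ⟨ψ.ker, hclosed⟩
    have hg₀' : g₀ ∉ (fixedField ψ.ker).fixingSubgroup := by
      rwa [hfix, MonoidHom.mem_ker]
    rw [IntermediateField.mem_fixingSubgroup_iff] at hg₀'
    push Not at hg₀'
    obtain ⟨y, hy, hy'⟩ := hg₀'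
    rw [mem_fixedField_iff] at hy
    have hm : ψ g₀ = -1 := (Int.units_eq_one_or _).resolve_left hg₀
    refine ⟨y - g₀ y, sub_ne_zero.2 (Ne.symm hy'), fun g => ?_⟩
    rcases Int.units_eq_one_or (ψ g) with hg | hg
    · have h1 : g y = y := hy g hg
      have h2 : (g₀⁻¹ * g * g₀) y = y := hy _ (by simp [MonoidHom.mem_ker, hg])
      have h3 : g (g₀ y) = g₀ y := by
        have := congrArg g₀ h2
        rwa [← AlgEquiv.mul_apply, mul_assoc, mul_inv_cancel_left] at this
      simp [hg, h1, h3]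
    · have h1 : (g * g₀) y = y := hy _ (by simp [MonoidHom.mem_ker, hg, hm])
      have h2 : (g₀⁻¹ * g) y = y := hy _ (by simp [MonoidHom.mem_ker, hg, hm])
      have h3 : g y = g₀ y := by
        have := congrArg g₀ h2
        rwa [← AlgEquiv.mul_apply, mul_inv_cancel_left] at this
      rw [AlgEquiv.mul_apply] at h1
      simp [hg, h1, h3]
  have hsN : s ∈ N := by
    rw [← InfiniteGalois.fixedField_fixingSubgroup N, mem_fixedField_iff]
    intro g hg
    simp [hs, MonoidHom.mem_ker.1 (hN hg)]
  have hsq : s ^ 2 ∈ (⊥ : IntermediateField K Ω) := by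
    refine (InfiniteGalois.mem_bot_iff_fixed _).2 fun g => ?_
    rw [map_pow, hs, mul_pow]
    rcases Int.units_eq_one_or (ψ g) with hg | hg <;> simp [hg]
  obtain ⟨t, ht⟩ := mem_bot.1 hsq
  have ht0 : t ≠ 0 := by
    rintro rfl
    rw [map_zero] at ht
    exact pow_ne_zero 2 hs0 ht.symm
  exact ⟨Units.mk0 t ht0, ⟨s, hsN⟩, ht.symm, hs⟩

theorem IsKummerChar.unique [CharZero Ω] {ψ ψ' : Gal(Ω/K) →* ℤˣ} {t t' : Kˣ}
    (h : IsKummerChar ψ t) (h' : IsKummerChar ψ' t')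
    (htt : (t : Kˣ ⧸ (powMonoidHom 2 : Kˣ →* Kˣ).range) = t') : ψ = ψ' := by
  obtain ⟨s, hst, hs⟩ := h
  obtain ⟨s', hst', hs'⟩ := h'
  obtain ⟨c, hc⟩ := QuotientGroup.eq.1 htt
  rw [powMonoidHom_apply, eq_inv_mul_iff_mul_eq] at hc
  have hs0 : s' ≠ 0 := by
    rintro rfl
    rw [zero_pow two_ne_zero, eq_comm, map_eq_zero] at hst'
    exact t'.ne_zero hst'
  have hsq : (s * algebraMap K Ω c) ^ 2 = s' ^ 2 := by
    rw [mul_pow, hst, hst', ← map_pow, ← map_mul, ← hc]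
    simp
  have hact : ∀ g, g s' = ((ψ g : ℤ) : Ω) * s' := by
    intro g
    rcases sq_eq_sq_iff_eq_or_eq_neg.1 hsq with h | h
    · rw [← h, map_mul, hs, AlgEquiv.commutes, mul_assoc]
    · rw [← neg_eq_iff_eq_neg.2 h, map_neg, map_mul, hs, AlgEquiv.commutes]
      ring
  ext g
  have := mul_right_cancel₀ hs0 ((hact g).symm.trans (hs' g))
  exact_mod_cast this

end Kummer

section Dihedral

/-- The character of `D₄` with kernel the rotations. -/
def dihedralSign : DihedralGroup 4 →* ℤˣ where
  toFun | .r _ => 1 | .sr _ => -1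
  map_one' := by decide
  map_mul' := by decide

/-- A character of `D₄` sending the generating rotation to `-1`. -/
def dihedralParity : DihedralGroup 4 →* ℤˣ where
  toFun | .r i => if i = 0 ∨ i = 2 then 1 else -1 | .sr i => if i = 0 ∨ i = 2 then 1 else -1
  map_one' := by decide
  map_mul' := by decide

/-- The embedding of `{±1}` as the centre of `D₄`. -/
def dihedralCenter : ℤˣ →* DihedralGroup 4 where
  toFun u := if u = 1 then 1 else .r 2
  map_one' := by decide
  map_mul' := by decide

theorem dihedralCenter_injective : Function.Injective dihedralCenter := by decide

theorem dihedralCenter_commute : ∀ u x, dihedralCenter u * x = x * dihedralCenter u := by decide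

theorem eq_mul_dihedralCenter : ∀ x y, dihedralSign x = dihedralSign y →
    dihedralParity x = dihedralParity y → ∃ u, x = y * dihedralCenter u := by decide

theorem exists_dihedral_twist {G : Type*} [Group G] (φ φ₀ : G →* DihedralGroup 4)
    (h1 : dihedralSign.comp φ = dihedralSign.comp φ₀)
    (h2 : dihedralParity.comp φ = dihedralParity.comp φ₀) :
    ∃ ψ : G →* ℤˣ, ∀ g, φ g = φ₀ g * dihedralCenter (ψ g) := by
  choose u hu using fun g => eq_mul_dihedralCenter (φ g) (φ₀ g)
    (DFunLike.congr_fun h1 g) (DFunLike.congr_fun h2 g)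
  refine ⟨MonoidHom.mk' u fun g h => dihedralCenter_injective ?_, hu⟩
  have := hu (g * h)
  rw [map_mul, map_mul, hu, hu, mul_assoc, mul_assoc, mul_right_inj] at this
  rw [map_mul, ← mul_right_inj (φ₀ h), ← this, ← mul_assoc, dihedralCenter_commute, mul_assoc]

end Dihedral

section DihedralFields

open IsDedekindDomain IsDedekindDomain.HeightOneSpectrum IntermediateField

theorem exists_center_eigenvector {K Ω : Type*} [Field K] [Field Ω] [Algebra K Ω]
    [IsGalois K Ω] {φ : Gal(Ω/K) →* DihedralGroup 4}
    (hφ : Function.Surjective φ) {L : IntermediateField K Ω} (hL : φ.ker = L.fixingSubgroup) :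
    ∃ x ∈ L, x ≠ 0 ∧ ∀ g u, φ g = dihedralCenter u → g x = ((u : ℤ) : Ω) * x := by
  obtain ⟨g₀, hg₀⟩ := hφ (dihedralCenter (-1))
  have hmem : ∀ y ∈ L, ∀ g, φ g = 1 → g y = y := by
    intro y hy g hg
    have : g ∈ L.fixingSubgroup := hL ▸ hg
    exact (IntermediateField.mem_fixingSubgroup_iff _ _).1 this y hy
  have hg₀' : g₀ ∉ L.fixingSubgroup := by
    rw [← hL, MonoidHom.mem_ker, hg₀]
    decide
  rw [IntermediateField.mem_fixingSubgroup_iff] at hg₀'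
  push Not at hg₀'
  obtain ⟨y, hy, hy'⟩ := hg₀'
  have hgy : ∀ g, φ g = 1 → g (g₀ y) = g₀ y := by
    intro g hg
    have := congrArg g₀ (hmem y hy (g₀⁻¹ * g * g₀) (by simp [hg]))
    rwa [← AlgEquiv.mul_apply, mul_assoc, mul_inv_cancel_left] at this
  refine ⟨y - g₀ y, L.sub_mem hy ?_, sub_ne_zero.2 (Ne.symm hy'), fun g u hg => ?_⟩
  · rw [← InfiniteGalois.fixedField_fixingSubgroup L, mem_fixedField_iff]
    exact fun g hg => hgy g (MonoidHom.mem_ker.1 (hL ▸ hg))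
  · rcases Int.units_eq_one_or u with rfl | rfl
    · have hg1 : φ g = 1 := by rw [hg, map_one]
      simp [hmem y hy g hg1, hgy g hg1]
    · have h1 := hmem y hy (g * g₀) (by rw [map_mul, hg, hg₀]; decide)
      have h2 := congrArg g₀ (hmem y hy (g₀⁻¹ * g) (by rw [map_mul, map_inv, hg, hg₀]; decide))
      rw [← AlgEquiv.mul_apply, mul_inv_cancel_left] at h2
      rw [AlgEquiv.mul_apply] at h1
      simp [h1, h2]

variable {K Ω : Type*} [Field K] [NumberField K] [Field Ω] [Algebra K Ω]

theorem mk_mem_selmerGroup {S : Set (HeightOneSpectrum (𝓞 K))} {t : Kˣ}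
    (h : ∀ p ∉ S, ∃ c : K, c ≠ 0 ∧ p.valuation K t = p.valuation K c ^ 2) :
    (t : Kˣ ⧸ (powMonoidHom 2 : Kˣ →* Kˣ).range) ∈
      selmerGroup (R := 𝓞 K) (K := K) (S := S) (n := 2) := by
  intro p hp
  obtain ⟨c, hc, htc⟩ := h p hp
  refine (valuationOfNeZeroMod_two_eq_one_iff p t).2
    ⟨p.valuationOfNeZero (Units.mk0 c hc), WithZero.coe_injective ?_⟩
  rw [WithZero.coe_pow, valuationOfNeZero_eq, valuationOfNeZero_eq, htc, Units.val_mk0]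

variable (K Ω) in
/-- The Galois extensions of `K` inside `Ω` with group `D₄` and ramified only at `S`. -/
def d4Fields (S : Set (HeightOneSpectrum (𝓞 K))) : Set (IntermediateField K Ω) :=
  {L | IsGalois K L ∧ ∃ _ : FiniteDimensional K L, Nonempty (Gal(L/K) ≃* DihedralGroup 4) ∧
    letI : NumberField L := numberField_of_finiteDimensional K L
    ramSet K L ⊆ S}

theorem exists_surjective_of_mem_d4Fields [IsGalois K Ω] {S : Set (HeightOneSpectrum (𝓞 K))}
    {L : IntermediateField K Ω} (hL : L ∈ d4Fields K Ω S) :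
    ∃ φ : Gal(Ω/K) →* DihedralGroup 4, Function.Surjective φ ∧ φ.ker = L.fixingSubgroup := by
  obtain ⟨hG, hfin, ⟨e⟩, -⟩ := hL
  refine ⟨e.toMonoidHom.comp (AlgEquiv.restrictNormalHom L),
    e.surjective.comp (AlgEquiv.restrictNormalHom_surjective Ω), ?_⟩
  rw [← restrictNormalHom_ker L]
  ext g
  simp [MonoidHom.mem_ker]

theorem mem_selmerGroup_of_mem_d4Fields {S : Set (HeightOneSpectrum (𝓞 K))}
    {L L₀ : IntermediateField K Ω} (hL : L ∈ d4Fields K Ω S) (hL₀ : L₀ ∈ d4Fields K Ω S)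
    {t : Kˣ} {s x x₀ : Ω} (hs : s ∈ L ⊔ L₀) (hx : x ∈ L) (hx₀ : x₀ ∈ L₀) (hx₀0 : x₀ ≠ 0)
    (ht : s ^ 2 = algebraMap K Ω t) (hxs : x₀ * s = x) :
    (t : Kˣ ⧸ (powMonoidHom 2 : Kˣ →* Kˣ).range) ∈
      selmerGroup (R := 𝓞 K) (K := K) (S := S) (n := 2) := by
  obtain ⟨_, _, -, hS⟩ := hL
  obtain ⟨_, _, -, hS₀⟩ := hL₀
  have hx0 : x ≠ 0 := by
    rw [← hxs]
    refine mul_ne_zero hx₀0 ?_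
    rintro rfl
    rw [zero_pow two_ne_zero, eq_comm, map_eq_zero] at ht
    exact t.ne_zero ht
  have : NumberField L := numberField_of_finiteDimensional K L
  have : NumberField L₀ := numberField_of_finiteDimensional K L₀
  have : NumberField ↥(L ⊔ L₀) := numberField_of_finiteDimensional K _
  let : Algebra L ↥(L ⊔ L₀) := (inclusion le_sup_left).toAlgebra
  let : Algebra L₀ ↥(L ⊔ L₀) := (inclusion le_sup_right).toAlgebra
  have : IsScalarTower K L ↥(L ⊔ L₀) := IsScalarTower.of_algebraMap_eq fun _ => rfl
  have : IsScalarTower K L₀ ↥(L ⊔ L₀) := IsScalarTower.of_algebraMap_eq fun _ => rfl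
  refine mk_mem_selmerGroup fun p hp => ?_
  exact exists_valuation_eq_sq (N := ↥(L ⊔ L₀)) (s := ⟨s, hs⟩) (x := (⟨x, hx⟩ : L))
    (x₀ := (⟨x₀, hx₀⟩ : L₀)) (fun h => hp (hS h)) (fun h => hp (hS₀ h)) (Subtype.ext ht)
    (Subtype.ext hxs) (fun h => hx0 (congrArg Subtype.val h))
    fun h => hx₀0 (congrArg Subtype.val h)

variable [IsGalois K Ω] [CharZero Ω]

theorem exists_selmer_of_character {S : Set (HeightOneSpectrum (𝓞 K))}
    {L : IntermediateField K Ω} (hL : L ∈ d4Fields K Ω S) (ψ : Gal(Ω/K) →* ℤˣ)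
    (hψ : L.fixingSubgroup ≤ ψ.ker) :
    ∃ t : Kˣ, (t : Kˣ ⧸ (powMonoidHom 2 : Kˣ →* Kˣ).range) ∈
      selmerGroup (R := 𝓞 K) (K := K) (S := S) (n := 2) ∧ IsKummerChar ψ t := by
  have := hL.2.1
  obtain ⟨t, s, ht, hs⟩ := exists_kummer_generator ψ L hψ
  exact ⟨t, mem_selmerGroup_of_mem_d4Fields hL hL (le_sup_left (a := L) s.2) s.2 L.one_mem
    one_ne_zero ht (one_mul _), s, ht, hs⟩

theorem exists_selmer_of_twist {S : Set (HeightOneSpectrum (𝓞 K))}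
    {L L₀ : IntermediateField K Ω} (hL : L ∈ d4Fields K Ω S) (hL₀ : L₀ ∈ d4Fields K Ω S)
    {φ φ₀ : Gal(Ω/K) →* DihedralGroup 4} (hφ : φ.ker = L.fixingSubgroup)
    (hφ₀ : φ₀.ker = L₀.fixingSubgroup) (hsurj : Function.Surjective φ₀) {ψ : Gal(Ω/K) →* ℤˣ}
    (hψ : ∀ g, φ g = φ₀ g * dihedralCenter (ψ g)) :
    ∃ t : Kˣ, (t : Kˣ ⧸ (powMonoidHom 2 : Kˣ →* Kˣ).range) ∈
      selmerGroup (R := 𝓞 K) (K := K) (S := S) (n := 2) ∧ IsKummerChar ψ t := by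
  have := hL.2.1
  have := hL₀.2.1
  have hker : (L ⊔ L₀).fixingSubgroup ≤ ψ.ker := by
    intro g hg
    rw [fixingSubgroup_sup, ← hφ, ← hφ₀] at hg
    have := hψ g
    rw [MonoidHom.mem_ker.1 hg.1, MonoidHom.mem_ker.1 hg.2, one_mul] at this
    exact dihedralCenter_injective (this.symm.trans (map_one _).symm)
  obtain ⟨t, s, ht, hs⟩ := exists_kummer_generator ψ (L ⊔ L₀) hker
  obtain ⟨x₀, hx₀, hx₀0, hx₀s⟩ := exists_center_eigenvector hsurj hφ₀
  refine ⟨t, mem_selmerGroup_of_mem_d4Fields hL hL₀ s.2 (x := x₀ * s) ?_ hx₀ hx₀0 ht rfl,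
    s, ht, hs⟩
  refine (InfiniteGalois.fixedField_fixingSubgroup L).le ((mem_fixedField_iff _ _).2 ?_)
  intro g hg
  have h1 : φ₀ g = dihedralCenter (ψ g) := by
    have := hψ g
    rw [MonoidHom.mem_ker.1 (hφ ▸ hg), eq_comm, mul_eq_one_iff_eq_inv, ← map_inv,
      Int.units_inv_eq_self] at this
    exact this
  rw [map_mul, hx₀s g _ h1, hs]
  rcases Int.units_eq_one_or (ψ g) with h | h <;> simp [h]

theorem card_d4Fields_le (S : Set (HeightOneSpectrum (𝓞 K)))
    [Finite (selmerGroup (R := 𝓞 K) (K := K) (S := S) (n := 2))] :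
    (d4Fields K Ω S).Finite ∧ (d4Fields K Ω S).ncard ≤
      Nat.card (selmerGroup (R := 𝓞 K) (K := K) (S := S) (n := 2)) ^ 3 := by
  set Sel := selmerGroup (R := 𝓞 K) (K := K) (S := S) (n := 2)
  choose φ hφsurj hφ using fun L : d4Fields K Ω S => exists_surjective_of_mem_d4Fields L.2
  have hchar : ∀ (χ : DihedralGroup 4 →* ℤˣ) (L : d4Fields K Ω S), ∃ σ : Sel, ∃ t : Kˣ,
      (t : Kˣ ⧸ (powMonoidHom 2 : Kˣ →* Kˣ).range) = σ ∧ IsKummerChar (χ.comp (φ L)) t := by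
    intro χ L
    obtain ⟨t, htS, ht⟩ := exists_selmer_of_character L.2 (χ.comp (φ L)) (by
      rw [← hφ]
      intro g hg
      simp [MonoidHom.mem_ker.1 hg])
    exact ⟨⟨_, htS⟩, t, rfl, ht⟩
  choose a ta hta ha using hchar
  have hchar_eq : ∀ χ L L', a χ L = a χ L' → χ.comp (φ L) = χ.comp (φ L') := by
    intro χ L L' h
    exact (ha χ L).unique (ha χ L') (by rw [hta, hta, h])
  let f : d4Fields K Ω S → Sel × Sel := fun L => (a dihedralSign L, a dihedralParity L)
  have htwist : ∀ L L₀ : d4Fields K Ω S, ∃ σ : Sel, f L = f L₀ → ∃ (t : Kˣ) (ψ : Gal(Ω/K) →* ℤˣ),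
      (t : Kˣ ⧸ (powMonoidHom 2 : Kˣ →* Kˣ).range) = σ ∧ IsKummerChar ψ t ∧
        ∀ g, φ L g = φ L₀ g * dihedralCenter (ψ g) := by
    intro L L₀
    by_cases h : f L = f L₀
    · obtain ⟨h1, h2⟩ := Prod.ext_iff.1 h
      obtain ⟨ψ, hψ⟩ := exists_dihedral_twist (φ L) (φ L₀) (hchar_eq _ _ _ h1) (hchar_eq _ _ _ h2)
      obtain ⟨t, htS, ht⟩ := exists_selmer_of_twist L.2 L₀.2 (hφ L) (hφ L₀) (hφsurj L₀) hψ
      exact ⟨⟨_, htS⟩, fun _ => ⟨t, ψ, rfl, ht, hψ⟩⟩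
    · exact ⟨1, fun h' => absurd h' h⟩
  choose τ hτ using htwist
  let β : d4Fields K Ω S → d4Fields K Ω S :=
    fun L => Set.rangeSplitting f (Set.rangeFactorization f L)
  have hβ : ∀ L, f L = f (β L) :=
    fun L => (Set.apply_rangeSplitting f (Set.rangeFactorization f L)).symm
  have hinj : Function.Injective fun L => (f L, τ L (β L)) := by
    intro L L' h
    obtain ⟨h1, h2⟩ := Prod.ext_iff.1 h
    have hββ : β L = β L' := congrArg (Set.rangeSplitting f) (Subtype.ext h1)
    obtain ⟨t, ψ, ht, hψt, hψ⟩ := hτ L _ (hβ L)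
    obtain ⟨t', ψ', ht', hψt', hψ'⟩ := hτ L' _ (hβ L')
    have hψψ : ψ = ψ' := hψt.unique hψt' (by rw [ht, ht']; exact congrArg _ h2)
    have hφφ : φ L = φ L' := by
      ext1 g
      rw [hψ, hψ', hψψ, hββ]
    refine Subtype.ext ?_
    rw [← InfiniteGalois.fixedField_fixingSubgroup (L : IntermediateField K Ω), ← hφ, hφφ, hφ,
      InfiniteGalois.fixedField_fixingSubgroup]
  refine ⟨Set.finite_coe_iff.1 (Finite.of_injective _ hinj), ?_⟩
  rw [← Nat.card_coe_set_eq]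
  refine (Nat.card_le_card_of_injective _ hinj).trans_eq ?_
  rw [Nat.card_prod, Nat.card_prod, pow_succ, sq]

end DihedralFields

section DihedralCount

open IsDedekindDomain

theorem finite_setOf_absNorm_le (K : Type*) [Field K] [NumberField K] (n : ℕ) :
    {p : HeightOneSpectrum (𝓞 K) | Ideal.absNorm p.asIdeal ≤ n}.Finite :=
  Set.Finite.of_injOn (f := HeightOneSpectrum.asIdeal) (t := {I | Ideal.absNorm I ≤ n})
    (fun _ hp => hp) (fun _ _ _ _ h => HeightOneSpectrum.ext h)
    (Ideal.finite_setOfPred_absNorm_le n)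

theorem finite_setOf_prod_absNorm_le (K : Type*) [Field K] [NumberField K] (X : ℝ) :
    {S : Finset (HeightOneSpectrum (𝓞 K)) |
      ((∏ p ∈ S, Ideal.absNorm p.asIdeal : ℕ) : ℝ) ≤ X}.Finite := by
  refine Set.Finite.of_finite_image (f := fun S => (S : Set (HeightOneSpectrum (𝓞 K))))
    ((finite_setOf_absNorm_le K ⌊X⌋₊).finite_subsets.subset ?_) Finset.coe_injective.injOn
  rintro _ ⟨S, hS, rfl⟩ p hp
  have hpos : 0 < ∏ p ∈ S, Ideal.absNorm p.asIdeal := Finset.prod_pos fun q _ =>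
    Nat.pos_of_ne_zero (Ideal.absNorm_eq_zero_iff.not.2 q.ne_bot)
  exact Nat.le_floor ((Nat.cast_le.2 (Nat.le_of_dvd hpos (Finset.dvd_prod_of_mem _ hp))).trans hS)

theorem ncard_d4Fields_le {K Ω : Type*} [Field K] [NumberField K] [Field Ω] [Algebra K Ω]
    [IsGalois K Ω] [CharZero Ω] (S : Finset (HeightOneSpectrum (𝓞 K))) :
    (d4Fields K Ω S).Finite ∧ (d4Fields K Ω S).ncard ≤
      Nat.card (selmerGroup (R := 𝓞 K) (K := K) (S := ∅) (n := 2)) ^ 3 *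
        8 ^ S.card := by
  obtain ⟨hfin, hcard⟩ := card_selmerGroup_le K S
  obtain ⟨hfin', hcard'⟩ := card_d4Fields_le (Ω := Ω) (S : Set (HeightOneSpectrum (𝓞 K)))
  refine ⟨hfin', hcard'.trans ((Nat.pow_le_pow_left hcard 3).trans_eq ?_)⟩
  rw [mul_pow, pow_right_comm]
  norm_num

theorem exists_mem_d4Fields {K Ω : Type*} [Field K] [NumberField K] [Field Ω] [Algebra K Ω]
    {L : IntermediateField K Ω} [IsGalois K L] [FiniteDimensional K L] [NumberField L]
    (hL : Module.finrank K L = 8) (hD : Nonempty (Gal(L/K) ≃* DihedralGroup 4)) {B : ℝ}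
    (hB : (relDiscAbsNorm K L : ℝ) ≤ B) :
    ∃ S : Finset (HeightOneSpectrum (𝓞 K)),
      ((∏ p ∈ S, Ideal.absNorm p.asIdeal : ℕ) : ℝ) ^ 4 ≤ B ∧ L ∈ d4Fields K Ω S := by
  have hfin := finite_ramSet K L
  refine ⟨hfin.toFinset, ?_, inferInstance, inferInstance, hD, by simp⟩
  refine le_trans ?_ hB
  exact_mod_cast prod_absNorm_pow_four_le hL hfin.toFinset (by simp)

end DihedralCount

/-- for a number field `K` with fixed algebraic closure `K̄`, the number
`N(B)` of intermediate fields `K ⊆ L ⊆ K̄` such that `L/K` is Galois of degree 8 with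
Galois group isomorphic to the dihedral group `D₄` of order 8 and with
`|N_{K/ℚ}(𝔡_{L/K})| ≤ B` satisfies `N(B) ≤ C·B^{1/2}` for some constant `C > 0` and all
`B ≥ 2`. -/
theorem stmt_18 (K : Type*) [Field K] [NumberField K]
    (Kbar : Type*) [Field Kbar] [Algebra K Kbar] [IsAlgClosure K Kbar] :
    ∃ C : ℝ, 0 < C ∧ ∀ B : ℝ, 2 ≤ B →
      (Set.ncard
          {L : IntermediateField K Kbar |
            IsGalois K ↥L ∧ Module.finrank K ↥L = 8 ∧
            Nonempty ((↥L ≃ₐ[K] ↥L) ≃* DihedralGroup 4) ∧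
            ∀ _h : FiniteDimensional K ↥L,
              letI : NumberField ↥L := numberField_of_finiteDimensional K ↥L
              (relDiscAbsNorm K ↥L : ℝ) ≤ B} : ℝ) ≤ C * B ^ ((1 : ℝ) / 2) := by
  have : IsGalois K Kbar := IsAlgClosure.isGalois K Kbar
  have : CharZero Kbar := charZero_of_injective_algebraMap (algebraMap K Kbar).injective
  obtain ⟨M, hM, hsum⟩ := exists_sum_pow_card_le K 8 (by norm_num)
  have := finite_selmerGroup_empty (𝓞 K) K
  set c := Nat.card (IsDedekindDomain.selmerGroup
    (R := 𝓞 K) (K := K) (S := ∅) (n := 2))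
  have hc0 : 0 < c := Nat.card_pos
  refine ⟨c ^ 3 * M, by positivity, fun B hB => ?_⟩
  have hB0 : 0 ≤ B := by linarith
  set X := B ^ ((1 : ℝ) / 4) with hX
  have hX0 : 0 ≤ X := Real.rpow_nonneg hB0 _
  have hX2 : X ^ 2 = B ^ ((1 : ℝ) / 2) := by
    rw [hX, ← Real.rpow_mul_natCast hB0]
    norm_num
  have hX4 : X ^ 4 = B := by
    rw [hX, ← Real.rpow_mul_natCast hB0]
    norm_num
  set T := (finite_setOf_prod_absNorm_le K X).toFinset with hT
  rw [← hX2]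
  calc _ ≤ ((⋃ S ∈ T, d4Fields K Kbar (S : Set _)).ncard : ℝ) := ?_
    _ ≤ ∑ S ∈ T, ((d4Fields K Kbar (S : Set _)).ncard : ℝ) := by
      exact_mod_cast Finset.set_ncard_biUnion_le _ _
    _ ≤ ∑ S ∈ T, (c : ℝ) ^ 3 * 8 ^ S.card := by
      refine Finset.sum_le_sum fun S _ => ?_
      exact_mod_cast (ncard_d4Fields_le S).2
    _ = c ^ 3 * ∑ S ∈ T, (8 : ℝ) ^ S.card := (Finset.mul_sum _ _ _).symm
    _ ≤ c ^ 3 * (M * X ^ 2) := by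
      refine mul_le_mul_of_nonneg_left (hsum X hX0 T fun S hS => ?_) (by positivity)
      simpa [hT] using hS
    _ = c ^ 3 * M * X ^ 2 := (mul_assoc _ _ _).symm
  refine Nat.cast_le.2 (Set.ncard_le_ncard ?_
    (T.finite_toSet.biUnion fun S _ => (ncard_d4Fields_le S).1))
  rintro L ⟨hG, h8, hD, hdisc⟩
  have hfin : FiniteDimensional K L := Module.finite_of_finrank_pos (by lia)
  have : NumberField L := numberField_of_finiteDimensional K L
  obtain ⟨S, hS, hLS⟩ := exists_mem_d4Fields h8 hD (hdisc hfin)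
  refine Set.mem_biUnion (x := S) ?_ hLS
  rw [hT, Set.Finite.coe_toFinset]
  exact le_of_pow_le_pow_left₀ four_ne_zero hX0 (hS.trans_eq hX4.symm)
end

section
/- Let K ⊆ L ⊆ M be a tower of number fields. Then |N_{K/ℚ}(𝔡_{M/K})| ≥ |N_{K/ℚ}(𝔡_{L/K})|^{[M:L]}, where 𝔡_{L/K} and 𝔡_{M/K} denote the relative discriminant ideals of L/K and M/K respectively, N_{K/ℚ} denotes the absolute norm of an ideal of the ring of integers of K, and [M:L] is the degree of M over L. -/
open NumberField

theorem relDiscAbsNorm_eq_absNorm_differentIdeal (K L : Type*) [Field K] [NumberField K] [Field L]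
    [NumberField L] [Algebra K L] :
    relDiscAbsNorm K L = Ideal.absNorm (differentIdeal (𝓞 K) (𝓞 L)) := by
  rw [relDiscAbsNorm, ← Ideal.relNorm_apply, Ideal.absNorm_relNorm]

attribute [local instance] FractionRing.liftAlgebra in
/-- The discriminant tower formula, in terms of absolute norms. -/
theorem relDiscAbsNorm_tower (K L M : Type*) [Field K] [NumberField K] [Field L] [NumberField L]
    [Field M] [NumberField M] [Algebra K L] [Algebra L M] [Algebra K M]
    [IsScalarTower K L M] :
    relDiscAbsNorm K M = relDiscAbsNorm L M * relDiscAbsNorm K L ^ Module.finrank L M := by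
  simp only [relDiscAbsNorm_eq_absNorm_differentIdeal]
  rw [differentIdeal_eq_differentIdeal_mul_differentIdeal (𝓞 K) (𝓞 L) (𝓞 M), map_mul,
    Ideal.absNorm_algebraMap, ← IsFractionRing.finrank_eq (𝓞 L) L (𝓞 M) M]

attribute [local instance] FractionRing.liftAlgebra in
theorem relDiscAbsNorm_pos (K L : Type*) [Field K] [NumberField K] [Field L]
    [NumberField L] [Algebra K L] : 0 < relDiscAbsNorm K L := by
  rw [relDiscAbsNorm_eq_absNorm_differentIdeal, Nat.pos_iff_ne_zero, Ne, Ideal.absNorm_eq_zero_iff]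
  exact differentIdeal_ne_bot

/-- for a tower `K ⊆ L ⊆ M` of number fields,
`|N_{K/ℚ}(𝔡_{M/K})| ≥ |N_{K/ℚ}(𝔡_{L/K})|^{[M:L]}`. -/
theorem stmt_19 (K L M : Type*) [Field K] [NumberField K] [Field L] [NumberField L]
    [Field M] [NumberField M] [Algebra K L] [Algebra L M] [Algebra K M]
    [IsScalarTower K L M] :
    relDiscAbsNorm K L ^ Module.finrank L M ≤ relDiscAbsNorm K M := by
  rw [relDiscAbsNorm_tower K L M]
  exact Nat.le_mul_of_pos_left _ (relDiscAbsNorm_pos L M)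
end
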